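/- Let L(λ)=A+λB be a regular n×n complex skew-symmetric matrix pencil (A^T=−A, B^T=−B) with pairwise distinct (finite or infinite) eigenvalues λ_1,…,λ_κ, where λ_i has partial multiplicities n_{i,1} ≥ … ≥ n_{i,g_i} > 0 (necessarily n and all n_{i,j} are even). Let r be a positive even integer and let Φ : ℂ^{(3r/2)n} → (n×n skew-symmetric pencils) be the map defined in the context. Then there exists a generic set G ⊆ ℂ^{(3r/2)n} such that for every x ∈ G, writing E = Φ(x): (a) L+E is a regular pencil; (b) for each i = 1,…,κ, the partial multiplicities of L+E at λ_i are exactly n_{i,r+1} ≥ … ≥ n_{i,g_i} (in particular, if r ≥ g_i then λ_i is not an eigenvalue of L+E); (c) every (finite or infinite) eigenvalue of L+E that is not an eigenvalue of L has algebraic multiplicity exactly two. -/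

import Mathlib

open Matrix Polynomial BigOperators

/-- The determinant of the pencil `A + λ B`, as a polynomial in `λ`. -/
noncomputable def pencilPoly (n : ℕ) (A B : Matrix (Fin n) (Fin n) ℂ) : Polynomial ℂ :=
  (A.map Polynomial.C + (Polynomial.X : Polynomial ℂ) • B.map Polynomial.C).det

/-- A pencil is regular if its determinant is not the zero polynomial. -/
def PencilRegular (n : ℕ) (A B : Matrix (Fin n) (Fin n) ℂ) : Prop :=
  pencilPoly n A B ≠ 0

/-- The order of vanishing of a polynomial at a point (`⊤` for the zero polynomial). -/
noncomputable def orderVan (p : Polynomial ℂ) (z : ℂ) : ℕ∞ :=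
  if p = 0 then ⊤ else (p.rootMultiplicity z : ℕ∞)

/-- `m_k(z)`: the minimum over all `k × k` submatrices `S(λ)` of `A + λB` of the order
of vanishing of `det S(λ)` at `z`. -/
noncomputable def minorOrder (n k : ℕ) (A B : Matrix (Fin n) (Fin n) ℂ) (z : ℂ) : ℕ∞ :=
  ⨅ (f : Fin k ↪ Fin n) (g : Fin k ↪ Fin n),
    orderVan (((A.map Polynomial.C + (Polynomial.X : Polynomial ℂ) • B.map Polynomial.C).submatrix f g).det) z

/-- The multiset of partial multiplicities of the pencil `A + λB` at the finite point
`z`: the positive values among `m_k(z) − m_{k−1}(z)`, `k = 1, …, n`. -/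
noncomputable def pmFin (n : ℕ) (A B : Matrix (Fin n) (Fin n) ℂ) (z : ℂ) : Multiset ℕ :=
  ((Multiset.range n).map fun k =>
    (minorOrder n (k + 1) A B z - minorOrder n k A B z).toNat).filter (fun m => 0 < m)

/-- The multiset of partial multiplicities of the pencil `A + λB` at a finite point
(`some z`) or at infinity (`none`, via the reversal pencil `B + λA` at `0`). -/
noncomputable def pmAt (n : ℕ) (A B : Matrix (Fin n) (Fin n) ℂ) : Option ℂ → Multiset ℕ
  | some z => pmFin n A B z
  | none => pmFin n B A 0

/-- `μ` (finite or infinite) is an eigenvalue of the pencil `A + λB` iff the list of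
partial multiplicities at `μ` is nonempty. -/
def IsEigenvalue (n : ℕ) (A B : Matrix (Fin n) (Fin n) ℂ) (μ : Option ℂ) : Prop :=
  pmAt n A B μ ≠ 0

/-- The algebraic multiplicity of a finite (`some z`) or infinite (`none`) eigenvalue. -/
noncomputable def algMultAt (n : ℕ) (A B : Matrix (Fin n) (Fin n) ℂ) : Option ℂ → ℕ
  | some z => (pencilPoly n A B).rootMultiplicity z
  | none => (pencilPoly n B A).rootMultiplicity 0

/-- A subset of `ι → ℂ` (i.e. `ℂ^N`, `N = #ι`) is generic if its complement is
contained in the common zero set of finitely many polynomials that are not all zero. -/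
def IsGenericC (ι : Type) [Fintype ι] (G : Set (ι → ℂ)) : Prop :=
  ∃ S : Finset (MvPolynomial ι ℂ), (∃ p ∈ S, p ≠ 0) ∧
    Gᶜ ⊆ { x | ∀ p ∈ S, MvPolynomial.eval x p = 0 }

/-- A subset of `ι → ℝ` (i.e. `ℝ^N`, `N = #ι`) is generic if its complement is
contained in the common zero set of finitely many real polynomials that are not all zero. -/
def IsGenericR (ι : Type) [Fintype ι] (G : Set (ι → ℝ)) : Prop :=
  ∃ S : Finset (MvPolynomial ι ℝ), (∃ p ∈ S, p ≠ 0) ∧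
    Gᶜ ⊆ { x | ∀ p ∈ S, MvPolynomial.eval x p = 0 }

/-- Parameter space `ℂ^{(3r/2) n}` for the skew-symmetric parameterization `Φ` (for
even `r`): the coordinates of `v_1,…,v_{r/2}, γ_1,…,γ_{r/2}, δ_1,…,δ_{r/2} ∈ ℂ^n`. -/
abbrev ParamSS (r n : ℕ) : Type :=
  (Fin (r / 2) × Fin n) ⊕ (Fin (r / 2) × Fin n) ⊕ (Fin (r / 2) × Fin n)

/-- Constant coefficient of the skew-symmetric pencil
`Φ(x)(λ) = Σ_j (v_j (γ_j + λ δ_j)ᵀ − (γ_j + λ δ_j) v_jᵀ)`. -/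
noncomputable def PhiSSA (n r : ℕ) (x : ParamSS r n → ℂ) : Matrix (Fin n) (Fin n) ℂ :=
  ∑ j : Fin (r / 2),
    (Matrix.vecMulVec (fun k => x (.inl (j, k))) (fun k => x (.inr (.inl (j, k))))
      - Matrix.vecMulVec (fun k => x (.inr (.inl (j, k)))) (fun k => x (.inl (j, k))))

/-- Coefficient of `λ` in the skew-symmetric pencil `Φ(x)(λ)`. -/
noncomputable def PhiSSB (n r : ℕ) (x : ParamSS r n → ℂ) : Matrix (Fin n) (Fin n) ℂ :=
  ∑ j : Fin (r / 2),
    (Matrix.vecMulVec (fun k => x (.inl (j, k))) (fun k => x (.inr (.inr (j, k))))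
      - Matrix.vecMulVec (fun k => x (.inr (.inr (j, k)))) (fun k => x (.inl (j, k))))

/-- The ideal of power series of order at least `c`. -/
noncomputable def orderIdeal (c : ℕ∞) : Ideal (PowerSeries ℂ) where
  carrier := {φ | c ≤ φ.order}
  add_mem' := fun {a b} ha hb =>
    (le_min ha hb).trans (PowerSeries.min_order_le_order_add a b)
  zero_mem' := by simp
  smul_mem' := fun a b hb => by
    have h : c ≤ b.order := hb
    change c ≤ (a * b).order
    rw [PowerSeries.order_mul]
    exact h.trans le_add_self

theorem mem_orderIdeal {c : ℕ∞} {φ : PowerSeries ℂ} : φ ∈ orderIdeal c ↔ c ≤ φ.order := Iff.rfl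

/-- The minimal order of the `k × k` minors of a matrix of power series; repeated rows or columns
are allowed, since the corresponding minors vanish. -/
noncomputable def minOrder {ι : Type*} (k : ℕ) (M : Matrix ι ι (PowerSeries ℂ)) : ℕ∞ :=
  ⨅ (f : Fin k → ι) (g : Fin k → ι), (M.submatrix f g).det.order

/-- The minimal order of the principal `k × k` minors of a matrix of power series. -/
noncomputable def principalMinOrder {ι : Type*} (k : ℕ) (M : Matrix ι ι (PowerSeries ℂ)) : ℕ∞ :=
  ⨅ f : Fin k → ι, (M.submatrix f f).det.order

section MinOrder

variable {ι : Type*}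

theorem minOrder_le {k : ℕ} (M : Matrix ι ι (PowerSeries ℂ)) (f g : Fin k → ι) :
    minOrder k M ≤ (M.submatrix f g).det.order :=
  iInf₂_le (f := fun f g : Fin k → ι => (M.submatrix f g).det.order) f g

theorem det_submatrix_comp_equiv {κ κ' R : Type*} [CommRing R] [Fintype κ] [DecidableEq κ]
    [Fintype κ'] [DecidableEq κ'] (M : Matrix ι ι R) (e : κ ≃ κ') (f g : κ' → ι) :
    (M.submatrix (f ∘ e) (g ∘ e)).det = (M.submatrix f g).det := by
  rw [← Matrix.submatrix_submatrix, Matrix.det_submatrix_equiv_self]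

theorem minOrder_le_of_card {κ : Type*} [Fintype κ] [DecidableEq κ] {k : ℕ}
    (hk : Fintype.card κ = k) (M : Matrix ι ι (PowerSeries ℂ)) (f g : κ → ι) :
    minOrder k M ≤ (M.submatrix f g).det.order := by
  rw [← det_submatrix_comp_equiv M (Fintype.equivFinOfCardEq hk).symm f g]
  exact minOrder_le M _ _

theorem principalMinOrder_le_of_card {κ : Type*} [Fintype κ] [DecidableEq κ] {k : ℕ}
    (hk : Fintype.card κ = k) (M : Matrix ι ι (PowerSeries ℂ)) (f : κ → ι) :
    principalMinOrder k M ≤ (M.submatrix f f).det.order := by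
  rw [← det_submatrix_comp_equiv M (Fintype.equivFinOfCardEq hk).symm f f]
  exact iInf_le _ _

theorem minOrder_zero (M : Matrix ι ι (PowerSeries ℂ)) : minOrder 0 M = 0 := by
  refine le_antisymm ((minOrder_le M Fin.elim0 Fin.elim0).trans ?_) (zero_le)
  simp

theorem principalMinOrder_zero (M : Matrix ι ι (PowerSeries ℂ)) : principalMinOrder 0 M = 0 := by
  refine le_antisymm ((iInf_le _ Fin.elim0).trans ?_) (zero_le)
  simp

theorem minOrder_le_succ (k : ℕ) (M : Matrix ι ι (PowerSeries ℂ)) :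
    minOrder k M ≤ minOrder (k + 1) M := by
  refine le_iInf₂ fun f g => ?_
  rw [← mem_orderIdeal, Matrix.det_succ_row_zero]
  refine Ideal.sum_mem _ fun j _ => Ideal.mul_mem_left _ _ ?_
  rw [mem_orderIdeal, Matrix.submatrix_submatrix]
  exact minOrder_le M _ _

theorem minOrder_mono (M : Matrix ι ι (PowerSeries ℂ)) : Monotone fun k => minOrder k M :=
  monotone_nat_of_le_succ fun k => minOrder_le_succ k M

theorem det_add_vecMulVec {κ R : Type*} [CommRing R] [Fintype κ] [DecidableEq κ]
    (A : Matrix κ κ R) (u w : κ → R) :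
    (A + Matrix.vecMulVec u w).det = A.det + ∑ i, u i * (A.updateRow i w).det := by
  have key : ∀ s : Finset κ,
      (A + Matrix.vecMulVec (fun i => if i ∈ s then u i else 0) w).det =
        A.det + ∑ i ∈ s, u i * (A.updateRow i w).det := by
    intro s
    induction s using Finset.induction_on with
    | empty =>
      have : Matrix.vecMulVec (fun i => if i ∈ (∅ : Finset κ) then u i else 0) w = 0 := by
        ext i j; simp [Matrix.vecMulVec_apply]
      rw [this]
      simp
    | insert a s ha ih =>
      set N := A + Matrix.vecMulVec (fun i => if i ∈ s then u i else 0) w with hN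
      have h1 : A + Matrix.vecMulVec (fun i => if i ∈ insert a s then u i else 0) w =
          N.updateRow a (N a + u a • w) := by
        ext i j
        by_cases hi : i = a
        · subst hi
          simp [hN, Matrix.vecMulVec_apply, ha]
        · simp [hN, Matrix.vecMulVec_apply, hi, Matrix.updateRow_ne]
      have h2 : (N.updateRow a w).det = (A.updateRow a w).det := by
        refine Matrix.det_eq_of_forall_row_eq_smul_add_const
          (fun i => if i ∈ s then u i else 0) a (by simp [ha]) fun i j => ?_
        by_cases hi : i = a
        · subst hi
          simp [ha]
        · simp [hN, Matrix.vecMulVec_apply, hi, Matrix.updateRow_ne]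
      rw [h1, Matrix.det_updateRow_add, Matrix.det_updateRow_smul, h2, Matrix.updateRow_eq_self, ih,
        Finset.sum_insert ha]
      ring
  simpa using key Finset.univ

theorem minOrder_le_add_vecMulVec (k : ℕ) (M : Matrix ι ι (PowerSeries ℂ))
    (u w : ι → PowerSeries ℂ) :
    minOrder k M ≤ minOrder (k + 1) (M + Matrix.vecMulVec u w) := by
  refine le_iInf₂ fun f g => ?_
  have h : (M + Matrix.vecMulVec u w).submatrix f g =
      M.submatrix f g + Matrix.vecMulVec (u ∘ f) (w ∘ g) := rfl
  rw [← mem_orderIdeal, h, det_add_vecMulVec]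
  refine Ideal.add_mem _ ((minOrder_le_succ k M).trans (minOrder_le M f g))
    (Ideal.sum_mem _ fun i _ => Ideal.mul_mem_left _ _ ?_)
  rw [Matrix.det_succ_row _ i]
  refine Ideal.sum_mem _ fun j _ => Ideal.mul_mem_left _ _ ?_
  rw [Matrix.submatrix_updateRow_succAbove, mem_orderIdeal, Matrix.submatrix_submatrix]
  exact minOrder_le M _ _

theorem minOrder_smul (k : ℕ) (a : PowerSeries ℂ) (M : Matrix ι ι (PowerSeries ℂ)) :
    minOrder k (a • M) = k * a.order + minOrder k M := by
  simp only [minOrder, Matrix.submatrix_smul, Pi.smul_apply, Matrix.det_smul, Fintype.card_fin,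
    PowerSeries.order_mul, PowerSeries.order_pow, nsmul_eq_mul, ENat.add_iInf]

theorem principalMinOrder_smul (k : ℕ) (a : PowerSeries ℂ) (M : Matrix ι ι (PowerSeries ℂ)) :
    principalMinOrder k (a • M) = k * a.order + principalMinOrder k M := by
  simp only [principalMinOrder, Matrix.submatrix_smul, Pi.smul_apply, Matrix.det_smul,
    Fintype.card_fin, PowerSeries.order_mul, PowerSeries.order_pow, nsmul_eq_mul, ENat.add_iInf]

end MinOrder

section Pivot

variable {ι R : Type*} [CommRing R]

/-- Elimination of the rows and columns `p`, `q` of a skew-symmetric matrix whose `(p, q)` entry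
is `1`. -/
def pivotComplement (N : Matrix ι ι R) (p q : ι) : Matrix ι ι R :=
  Matrix.of fun i j => N i j + N i p * N q j - N i q * N p j

theorem pivotComplement_transpose {N : Matrix ι ι R} (hN : Nᵀ = -N) (p q : ι) :
    (pivotComplement N p q)ᵀ = -pivotComplement N p q := by
  have h : ∀ i j, N j i = -N i j := fun i j => congrFun (congrFun hN i) j
  ext i j
  simp only [pivotComplement, Matrix.transpose_apply, Matrix.of_apply, Matrix.neg_apply]
  rw [h i j, h p j, h i q, h q j, h i p]
  ring

theorem eq_pivotComplement_add (N : Matrix ι ι R) (p q : ι) :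
    N = pivotComplement N p q + Matrix.vecMulVec (fun i => -N i p) (N q) +
      Matrix.vecMulVec (fun i => N i q) (N p) := by
  ext i j
  simp only [pivotComplement, Matrix.add_apply, Matrix.of_apply, Matrix.vecMulVec_apply]
  ring

theorem det_submatrix_pivot (N : Matrix ι ι R) {p q : ι} (hpp : N p p = 0) (hqq : N q q = 0)
    (hpq : N p q = 1) (hqp : N q p = -1) {k : ℕ} (f g : Fin k → ι) :
    (N.submatrix (Sum.elim ![p, q] f) (Sum.elim ![p, q] g)).det =
      ((pivotComplement N p q).submatrix f g).det := by
  have hblocks : N.submatrix (Sum.elim ![p, q] f) (Sum.elim ![p, q] g) =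
      Matrix.fromBlocks !![0, 1; -1, 0] (N.submatrix ![p, q] g) (N.submatrix f ![p, q])
        (N.submatrix f g) := by
    ext i j
    rcases i with i | i <;> rcases j with j | j
    · rw [Matrix.fromBlocks_apply₁₁]
      fin_cases i <;> fin_cases j <;> simp [hpp, hqq, hpq, hqp]
    all_goals rfl
  let _ : Invertible (!![0, 1; -1, 0] : Matrix (Fin 2) (Fin 2) R) :=
    ⟨!![0, -1; 1, 0], by simp [Matrix.one_fin_two], by simp [Matrix.one_fin_two]⟩
  have hinv : ⅟(!![0, 1; -1, 0] : Matrix (Fin 2) (Fin 2) R) = !![0, -1; 1, 0] := rfl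
  rw [hblocks, Matrix.det_fromBlocks₁₁, hinv]
  simp only [Matrix.det_fin_two_of, mul_zero, mul_neg, mul_one, zero_sub, neg_neg, one_mul]
  congr 1
  ext i j
  simp only [pivotComplement, Matrix.sub_apply, Matrix.mul_apply, Fin.sum_univ_two,
    Matrix.submatrix_apply, Matrix.of_apply, Matrix.cons_val', Matrix.cons_val_zero,
    Matrix.cons_val_one, Matrix.cons_val_fin_one]
  ring

end Pivot

theorem diag_eq_zero_of_transpose_eq_neg {ι : Type*} {M : Matrix ι ι (PowerSeries ℂ)}
    (hM : Mᵀ = -M) (i : ι) : M i i = 0 := by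
  have h : M i i = -M i i := congrFun (congrFun hM i) i
  ext k
  have hk := congrArg (PowerSeries.coeff k) h
  simpa [self_eq_neg] using hk

theorem minOrder_pivot {ι : Type*} {N : Matrix ι ι (PowerSeries ℂ)} (hN : Nᵀ = -N) {p q : ι}
    (hpq : N p q = 1) (k : ℕ) : minOrder (k + 2) N = minOrder k (pivotComplement N p q) := by
  have hqp : N q p = -1 := by rw [← hpq]; exact congrFun (congrFun hN p) q
  apply le_antisymm
  · refine le_iInf₂ fun f g => ?_
    rw [← det_submatrix_pivot N (diag_eq_zero_of_transpose_eq_neg hN p)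
      (diag_eq_zero_of_transpose_eq_neg hN q) hpq hqp f g]
    exact minOrder_le_of_card (by simp [add_comm]) N _ _
  · conv_rhs => rw [eq_pivotComplement_add N p q]
    exact (minOrder_le_add_vecMulVec _ _ _ _).trans (minOrder_le_add_vecMulVec _ _ _ _)

theorem principalMinOrder_pivot_le {ι : Type*} {N : Matrix ι ι (PowerSeries ℂ)} (hN : Nᵀ = -N)
    {p q : ι} (hpq : N p q = 1) (k : ℕ) :
    principalMinOrder (k + 2) N ≤ principalMinOrder k (pivotComplement N p q) := by
  have hqp : N q p = -1 := by rw [← hpq]; exact congrFun (congrFun hN p) q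
  refine le_iInf fun f => ?_
  rw [← det_submatrix_pivot N (diag_eq_zero_of_transpose_eq_neg hN p)
    (diag_eq_zero_of_transpose_eq_neg hN q) hpq hqp f f]
  exact principalMinOrder_le_of_card (by simp [add_comm]) N _

theorem dvd_of_order_le {a b : PowerSeries ℂ} (h : a.order ≤ b.order) : a ∣ b := by
  by_cases hb : b = 0
  · simp [hb]
  have ha : a ≠ 0 := by
    rintro rfl
    simp [hb] at h
  have hdvd : PowerSeries.X ^ a.order.toNat ∣ b :=
    (pow_dvd_pow _ (ENat.toNat_le_toNat h (by simpa using hb))).trans PowerSeries.X_pow_order_dvd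
  have hunit : IsUnit (PowerSeries.divXPowOrder a) := by
    rw [PowerSeries.isUnit_iff_constantCoeff, isUnit_iff_ne_zero]
    exact fun h => ha (PowerSeries.constantCoeff_divXPowOrder_eq_zero_iff.mp h)
  rw [← PowerSeries.X_pow_order_mul_divXPowOrder (f := a)]
  exact (hunit.mul_right_dvd).mpr hdvd

/-- Local Smith-type invariants of a skew-symmetric matrix of power series: the minimal orders of
its minors grow by a monotone sequence whose terms come in equal pairs, and the even ones are
attained by principal minors. -/
theorem exists_skew_invariants {ι : Type*} [Fintype ι] [DecidableEq ι]
    (M : Matrix ι ι (PowerSeries ℂ)) (hM : Mᵀ = -M) :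
    ∃ e : ℕ → ℕ∞, Monotone e ∧ (∀ s, e (2 * s + 1) = e (2 * s)) ∧
      (∀ k, minOrder (k + 1) M = minOrder k M + e k) ∧
      ∀ s, principalMinOrder (2 * s) M ≤ minOrder (2 * s) M := by
  classical
  induction hm : (Finset.univ.filter fun i => M i ≠ 0).card using Nat.strong_induction_on
    generalizing M with
  | _ m ih =>
  by_cases h0 : M = 0
  · have htop : ∀ k, minOrder (k + 1) M = ⊤ := by
      intro k
      rw [h0]
      simp [minOrder]
    refine ⟨fun _ => ⊤, monotone_const, fun _ => rfl, fun k => by rw [htop, add_top], fun s => ?_⟩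
    rcases s with _ | s
    · rw [mul_zero, principalMinOrder_zero]
      exact zero_le
    · rw [show 2 * (s + 1) = (2 * s + 1) + 1 by ring, htop]
      exact le_top
  have hne : (Finset.univ : Finset (ι × ι)).Nonempty := by
    by_contra h
    rw [Finset.not_nonempty_iff_eq_empty] at h
    refine h0 (Matrix.ext fun i j => ?_)
    have : (i, j) ∈ (Finset.univ : Finset (ι × ι)) := Finset.mem_univ _
    rw [h] at this
    exact absurd this (Finset.notMem_empty _)
  obtain ⟨⟨p, q⟩, -, hmin⟩ := Finset.exists_min_image Finset.univ
    (fun x : ι × ι => (M x.1 x.2).order) hne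
  have hdvd : ∀ i j, M p q ∣ M i j := fun i j =>
    dvd_of_order_le (hmin (i, j) (Finset.mem_univ _))
  set a := M p q with ha
  have ha0 : a ≠ 0 := by
    intro h
    refine h0 (Matrix.ext fun i j => ?_)
    exact zero_dvd_iff.mp (h ▸ hdvd i j)
  choose N' hN' using hdvd
  set N : Matrix ι ι (PowerSeries ℂ) := Matrix.of N' with hNdef
  have hMN : M = a • N := Matrix.ext fun i j => hN' i j
  have hpq : N p q = 1 := by
    have h : a = a * N p q := hN' p q
    exact mul_left_cancel₀ ha0 (by rw [← h, mul_one])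
  have hN : Nᵀ = -N := by
    ext1 i j
    have h : M j i = -M i j := congrFun (congrFun hM i) j
    rw [hMN] at h
    refine mul_left_cancel₀ ha0 ?_
    simpa [Matrix.smul_apply] using h
  have hqp : N q p = -1 := by rw [← hpq]; exact congrFun (congrFun hN p) q
  have hpp := diag_eq_zero_of_transpose_eq_neg hN p
  have hqq := diag_eq_zero_of_transpose_eq_neg hN q
  have hcard : (Finset.univ.filter fun i => pivotComplement N p q i ≠ 0).card < m := by
    rw [← hm]
    refine Finset.card_lt_card ⟨fun i hi => ?_, fun h => ?_⟩
    · simp only [Finset.mem_filter, Finset.mem_univ, true_and] at hi ⊢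
      contrapose! hi
      have hrow : ∀ j, N i j = 0 := fun j => by
        have h := congrFun hi j
        rw [hMN] at h
        simpa [ha0] using h
      funext j
      simp [pivotComplement, hrow]
    · have hmem : p ∈ Finset.univ.filter fun i => M i ≠ 0 := by
        simp only [Finset.mem_filter, Finset.mem_univ, true_and]
        exact fun h => ha0 (congrFun h q)
      have := h hmem
      simp only [Finset.mem_filter, Finset.mem_univ, true_and] at this
      refine this (funext fun j => ?_)
      simp [pivotComplement, hpp, hpq]
  obtain ⟨e, he, hpair, hstep, hprin⟩ := ih _ hcard (pivotComplement N p q)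
    (pivotComplement_transpose hN p q) rfl
  have h2 : minOrder 2 N = 0 := (minOrder_pivot hN hpq 0).trans (minOrder_zero _)
  have h1 : minOrder 1 N = 0 := le_antisymm (h2 ▸ minOrder_le_succ 1 N) zero_le
  refine ⟨fun k => a.order + if k < 2 then 0 else e (k - 2), ?_, ?_, ?_, ?_⟩
  · refine fun k l hkl => add_le_add le_rfl ?_
    split_ifs with hk hl hl
    · exact le_rfl
    · exact zero_le
    · omega
    · exact he (by omega)
  · intro s
    rcases s with _ | s
    · simp
    · simp only [show ¬ 2 * (s + 1) + 1 < 2 by omega, show ¬ 2 * (s + 1) < 2 by omega, if_false,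
        show 2 * (s + 1) + 1 - 2 = 2 * s + 1 by omega, show 2 * (s + 1) - 2 = 2 * s by omega, hpair]
  · intro k
    rw [hMN, minOrder_smul, minOrder_smul]
    rcases k with _ | _ | k
    · simp [minOrder_zero, h1]
    · simp [h1, h2]
      ring
    · rw [minOrder_pivot hN hpq k, show k + 1 + 1 + 1 = k + 1 + 2 by ring,
        minOrder_pivot hN hpq (k + 1), hstep]
      simp only [show ¬ k + 1 + 1 < 2 by omega, if_false,
        show k + 1 + 1 - 2 = k by omega]
      push_cast
      ring
  · intro s
    rcases s with _ | s
    · rw [mul_zero, principalMinOrder_zero]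
      exact zero_le
    · rw [hMN, minOrder_smul, principalMinOrder_smul, show 2 * (s + 1) = 2 * s + 2 by ring,
        minOrder_pivot hN hpq]
      exact add_le_add le_rfl ((principalMinOrder_pivot_le hN hpq _).trans (hprin s))

section Perturbation

/-- The skew-symmetric matrix `v wᵀ - w vᵀ`. -/
def skewPair {ι R : Type*} [CommRing R] (v w : ι → R) : Matrix ι ι R :=
  Matrix.vecMulVec v w - Matrix.vecMulVec w v

theorem skewPair_transpose {ι R : Type*} [CommRing R] (v w : ι → R) :
    (skewPair v w)ᵀ = -skewPair v w := by
  ext i j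
  simp [skewPair, Matrix.vecMulVec_apply, mul_comm]

theorem sum_skewPair_transpose {ι R σ : Type*} [CommRing R] (s : Finset σ) (v w : σ → ι → R) :
    (∑ j ∈ s, skewPair (v j) (w j))ᵀ = -∑ j ∈ s, skewPair (v j) (w j) := by
  simp [Matrix.transpose_sum, skewPair_transpose]

theorem minOrder_le_add_sum_skewPair {ι σ : Type*} (s : Finset σ)
    (v w : σ → ι → PowerSeries ℂ) (k : ℕ) (M : Matrix ι ι (PowerSeries ℂ)) :
    minOrder (k - 2 * s.card) M ≤ minOrder k (M + ∑ j ∈ s, skewPair (v j) (w j)) := by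
  classical
  induction s using Finset.induction_on generalizing k with
  | empty => simp
  | insert a s ha ih =>
    rw [Finset.card_insert_of_notMem ha, Finset.sum_insert ha]
    rcases lt_or_ge k 2 with hk | hk
    · rw [show k - 2 * (s.card + 1) = 0 by omega, minOrder_zero]
      exact zero_le
    obtain ⟨k, rfl⟩ := Nat.exists_eq_add_of_le' hk
    rw [show k + 2 - 2 * (s.card + 1) = k - 2 * s.card by omega]
    refine (ih k).trans ((minOrder_le_add_vecMulVec _ _ (v a) (w a)).trans
      ((minOrder_le_add_vecMulVec _ _ (-w a) (v a)).trans (le_of_eq ?_)))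
    congr 1
    rw [skewPair, Matrix.neg_vecMulVec]
    abel

theorem det_add_block_add_det_sub_block {κ R : Type*} [CommRing R] [Fintype κ] [DecidableEq κ]
    (N : Matrix (Fin 2 ⊕ κ) (Fin 2 ⊕ κ) R) :
    (N + Matrix.fromBlocks !![0, 1; -1, 0] 0 0 0).det +
      (N + -Matrix.fromBlocks !![0, 1; -1, 0] 0 0 0).det =
      2 * N.det + 2 * N.toBlocks₂₂.det := by
  set e₀ : Fin 2 ⊕ κ → R := Pi.single (Sum.inl 0) 1
  set e₁ : Fin 2 ⊕ κ → R := Pi.single (Sum.inl 1) 1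
  set rows : (Fin 2 ⊕ κ → R) → (Fin 2 ⊕ κ → R) → Matrix (Fin 2 ⊕ κ) (Fin 2 ⊕ κ) R :=
    fun x y => (N.updateRow (Sum.inl 0) x).updateRow (Sum.inl 1) y with hrows
  have hne : (Sum.inl 0 : Fin 2 ⊕ κ) ≠ Sum.inl 1 := by simp
  have hadd₂ : ∀ x y c y', (rows x (y + c • y')).det = (rows x y).det + c * (rows x y').det := by
    intro x y c y'
    rw [hrows, Matrix.det_updateRow_add, Matrix.det_updateRow_smul]
  have hadd₁ : ∀ x c x' y, (rows (x + c • x') y).det = (rows x y).det + c * (rows x' y).det := by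
    intro x c x' y
    simp only [hrows]
    rw [Matrix.updateRow_comm _ hne, Matrix.det_updateRow_add, Matrix.det_updateRow_smul,
      Matrix.updateRow_comm _ hne.symm, Matrix.updateRow_comm _ hne.symm]
  have hN : rows (N (Sum.inl 0)) (N (Sum.inl 1)) = N := by
    ext i j
    by_cases h1 : i = Sum.inl 1
    · subst h1; simp [hrows]
    · by_cases h0 : i = Sum.inl 0
      · subst h0; simp [hrows]
      · simp [hrows, Matrix.updateRow_ne, h0, h1]
  have hplus : ∀ c : R, N + c • Matrix.fromBlocks !![0, 1; -1, 0] 0 0 0 =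
      rows (N (Sum.inl 0) + c • e₁) (N (Sum.inl 1) + (-c) • e₀) := by
    intro c
    ext i j
    rcases i with i | i
    · fin_cases i <;> rcases j with j | j
      · fin_cases j <;> simp [hrows, e₀, e₁]
      · simp [hrows, e₀, e₁]
      · fin_cases j <;> simp [hrows, e₀, e₁]
      · simp [hrows, e₀, e₁]
    · rcases j with j | j <;> simp [hrows, Matrix.updateRow_ne]
  have hlast : (rows e₁ e₀).det = -N.toBlocks₂₂.det := by
    have h : rows e₁ e₀ =
        Matrix.fromBlocks !![0, 1; 1, 0] 0 N.toBlocks₂₁ N.toBlocks₂₂ := by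
      ext i j
      rcases i with i | i
      · fin_cases i <;> rcases j with j | j
        · fin_cases j <;> simp [hrows, e₀, e₁]
        · simp [hrows, e₀, e₁]
        · fin_cases j <;> simp [hrows, e₀, e₁]
        · simp [hrows, e₀, e₁]
      · rcases j with j | j <;> simp [hrows, Matrix.updateRow_ne, Matrix.toBlocks₂₁,
          Matrix.toBlocks₂₂]
    rw [h, Matrix.det_fromBlocks_zero₁₂]
    simp [Matrix.det_fin_two_of]
  have h1 := hplus 1
  have h2 := hplus (-1)
  rw [one_smul] at h1
  rw [neg_smul, one_smul] at h2
  rw [h1, h2, hadd₁, hadd₂, hadd₂, hadd₁, hadd₂, hadd₂, hN, hlast]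
  ring

theorem exists_skewPair_minOrder_le {n : ℕ} (M : Matrix (Fin n) (Fin n) (PowerSeries ℂ))
    (hM : Mᵀ = -M) {k : ℕ} (hk : Even k) (hkn : k ≤ n) :
    ∃ v w : Fin n → ℂ, minOrder k (M + (skewPair v w).map PowerSeries.C) ≤ minOrder (k - 2) M := by
  obtain ⟨s, hs⟩ := hk
  rcases s with _ | s
  · refine ⟨0, 0, ?_⟩
    rw [hs, minOrder_zero]
    exact zero_le
  obtain rfl : k = 2 * s + 2 := by omega
  rw [Nat.add_sub_cancel]
  obtain ⟨-, -, -, -, hprin⟩ := exists_skew_invariants M hM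
  have : Nonempty (Fin (2 * s) → Fin n) := ⟨fun _ => ⟨0, by omega⟩⟩
  obtain ⟨f, hf⟩ := ENat.exists_eq_iInf
    (fun f : Fin (2 * s) → Fin n => (M.submatrix f f).det.order)
  replace hf : (M.submatrix f f).det.order ≤ minOrder (2 * s) M := hf.le.trans (hprin s)
  by_cases hdet : (M.submatrix f f).det = 0
  · rw [hdet, PowerSeries.order_zero, top_le_iff] at hf
    exact ⟨0, 0, hf ▸ le_top⟩
  have hinj : Function.Injective f := by
    intro i j hij
    by_contra hne
    exact hdet (Matrix.det_zero_of_row_eq hne (by ext l; simp [hij]))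
  obtain ⟨a, ha, b, hb, hab⟩ : ∃ a ∈ (Finset.univ.image f)ᶜ, ∃ b ∈ (Finset.univ.image f)ᶜ, a ≠ b := by
    rw [← Finset.one_lt_card, Finset.card_compl, Finset.card_image_of_injective _ hinj]
    simp
    omega
  simp only [Finset.mem_compl, Finset.mem_image, Finset.mem_univ, true_and, not_exists] at ha hb
  set K : Fin 2 ⊕ Fin (2 * s) → Fin n := Sum.elim ![a, b] f with hK
  have hblock : ∀ c : ℂ, (M + (skewPair (Pi.single a c) (Pi.single b 1)).map
      PowerSeries.C).submatrix K K =
      M.submatrix K K + PowerSeries.C c • Matrix.fromBlocks !![0, 1; -1, 0] 0 0 0 := by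
    intro c
    ext1 i j
    rcases i with i | i
    · fin_cases i <;> rcases j with j | j
      · fin_cases j <;> simp [hK, skewPair, Matrix.vecMulVec_apply, hab, hab.symm]
      · simp [hK, skewPair, Matrix.vecMulVec_apply, hab, ha, hb]
      · fin_cases j <;> simp [hK, skewPair, Matrix.vecMulVec_apply, hab, hab.symm]
      · simp [hK, skewPair, Matrix.vecMulVec_apply, hab.symm, ha, hb]
    · rcases j with j | j <;> simp [hK, skewPair, Matrix.vecMulVec_apply, ha, hb]
  by_contra! hcon
  have hlt : ∀ c : ℂ, minOrder (2 * s) M < (M.submatrix K K +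
      PowerSeries.C c • Matrix.fromBlocks !![0, 1; -1, 0] 0 0 0).det.order := by
    intro c
    refine (hcon (Pi.single a c) (Pi.single b 1)).trans_le ?_
    rw [← hblock]
    exact minOrder_le_of_card (by simp [add_comm]) _ _ _
  have h0 := hlt 0
  have h1 := hlt 1
  have h2 := hlt (-1)
  rw [map_zero, zero_smul, add_zero] at h0
  rw [map_one, one_smul] at h1
  rw [map_neg, map_one, neg_smul, one_smul] at h2
  set m := min (M.submatrix K K).det.order
    (min (M.submatrix K K + Matrix.fromBlocks !![0, 1; -1, 0] 0 0 0).det.order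
      (M.submatrix K K + -Matrix.fromBlocks !![0, 1; -1, 0] 0 0 0).det.order) with hm
  have hmem : (M.submatrix f f).det ∈ orderIdeal m := by
    have hid := det_add_block_add_det_sub_block (M.submatrix K K)
    have h22 : (M.submatrix K K).toBlocks₂₂ = M.submatrix f f := rfl
    rw [h22] at hid
    have hhalf : (M.submatrix f f).det = PowerSeries.C (1 / 2 : ℂ) *
        ((M.submatrix K K + Matrix.fromBlocks !![0, 1; -1, 0] 0 0 0).det +
          (M.submatrix K K + -Matrix.fromBlocks !![0, 1; -1, 0] 0 0 0).det -
          2 * (M.submatrix K K).det) := by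
      have htwo : PowerSeries.C (1 / 2 : ℂ) * 2 = 1 := by
        rw [← map_ofNat (PowerSeries.C (R := ℂ)) 2, ← map_mul]
        norm_num
      rw [hid]
      linear_combination -(M.submatrix f f).det * htwo
    rw [hhalf]
    refine Ideal.mul_mem_left _ _ (Ideal.sub_mem _ (Ideal.add_mem _ ?_ ?_)
      (Ideal.mul_mem_left _ _ ?_))
    · exact mem_orderIdeal.mpr (hm ▸ (min_le_right _ _).trans (min_le_left _ _))
    · exact mem_orderIdeal.mpr (hm ▸ (min_le_right _ _).trans (min_le_right _ _))
    · exact mem_orderIdeal.mpr (hm ▸ min_le_left _ _)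
  have hgt : minOrder (2 * s) M < m := lt_min h0 (lt_min h1 h2)
  exact absurd (hgt.trans_le ((mem_orderIdeal.mp hmem).trans hf)) (lt_irrefl _)

theorem map_C_transpose_eq_neg {ι : Type*} {E : Matrix ι ι ℂ} (hE : Eᵀ = -E) :
    (E.map PowerSeries.C)ᵀ = -E.map PowerSeries.C := by
  rw [← Matrix.transpose_map, hE]
  ext1 i j
  simp

theorem exists_sum_skewPair_minOrder_le {n : ℕ} (M : Matrix (Fin n) (Fin n) (PowerSeries ℂ))
    (hM : Mᵀ = -M) (q : ℕ) {k : ℕ} (hk : Even k) (hkn : k ≤ n) :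
    ∃ v w : Fin q → Fin n → ℂ,
      minOrder k (M + (∑ j, skewPair (v j) (w j)).map PowerSeries.C) ≤
        minOrder (k - 2 * q) M := by
  induction q generalizing k with
  | zero => exact ⟨Fin.elim0, Fin.elim0, by simp⟩
  | succ q ih =>
    obtain ⟨v, w, hvw⟩ := ih (k := k - 2) (by obtain ⟨s, rfl⟩ := hk; exact ⟨s - 1, by omega⟩)
      (by omega)
    obtain ⟨v', w', hvw'⟩ := exists_skewPair_minOrder_le
      (M + (∑ j, skewPair (v j) (w j)).map PowerSeries.C)
      (by rw [Matrix.transpose_add, hM, map_C_transpose_eq_neg (sum_skewPair_transpose _ v w),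
        neg_add]) hk hkn
    refine ⟨Fin.snoc v v', Fin.snoc w w', ?_⟩
    rw [Fin.sum_univ_castSucc]
    simp only [Fin.snoc_castSucc, Fin.snoc_last]
    rw [Matrix.map_add _ (map_add _), ← add_assoc,
      show k - 2 * (q + 1) = k - 2 - 2 * q by omega]
    exact hvw'.trans hvw

end Perturbation

section Germ

/-- The matrix polynomial `A + λ B`. -/
noncomputable def pencilMatrix {ι R : Type*} [CommRing R] (A B : Matrix ι ι R) :
    Matrix ι ι (Polynomial R) :=
  A.map Polynomial.C + (Polynomial.X : Polynomial R) • B.map Polynomial.C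

theorem pencilMatrix_map {ι R S : Type*} [CommRing R] [CommRing S] (f : R →+* S)
    (A B : Matrix ι ι R) :
    (pencilMatrix A B).map (Polynomial.mapRingHom f) = pencilMatrix (A.map f) (B.map f) := by
  ext1 i j
  simp [pencilMatrix]

/-- The Taylor expansion of a polynomial at `z`, as a power series. -/
noncomputable def germ (z : ℂ) : Polynomial ℂ →+* PowerSeries ℂ :=
  Polynomial.coeToPowerSeries.ringHom.comp (Polynomial.taylorAlgHom z : ℂ[X] →+* ℂ[X])

theorem germ_apply (z : ℂ) (p : Polynomial ℂ) :
    germ z p = ((Polynomial.taylor z p : Polynomial ℂ) : PowerSeries ℂ) := rfl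

theorem coeff_germ (z : ℂ) (p : Polynomial ℂ) (c : ℕ) :
    PowerSeries.coeff c (germ z p) = (Polynomial.taylor z p).coeff c := by
  rw [germ_apply, Polynomial.coeff_coe]

theorem germ_C (z a : ℂ) : germ z (Polynomial.C a) = PowerSeries.C a := by
  simp [germ_apply]

theorem germ_X (z : ℂ) : germ z Polynomial.X = PowerSeries.X + PowerSeries.C z := by
  simp [germ_apply]

theorem orderVan_eq_order (p : Polynomial ℂ) (z : ℂ) : orderVan p z = (germ z p).order := by
  unfold orderVan
  split_ifs with hp
  · simp [hp]
  · symm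
    rw [PowerSeries.order_eq_nat, Polynomial.rootMultiplicity_eq_natTrailingDegree,
      ← Polynomial.taylor_apply]
    simp only [coeff_germ]
    refine ⟨?_, fun i hi => Polynomial.coeff_eq_zero_of_lt_natTrailingDegree hi⟩
    rw [← Polynomial.trailingCoeff, Ne, Polynomial.trailingCoeff_eq_zero, Polynomial.taylor_eq_zero]
    exact hp

/-- The Taylor expansion at `z` of the pencil `A + λ B`. -/
noncomputable def pencilGerm {ι : Type*} (A B : Matrix ι ι ℂ) (z : ℂ) :
    Matrix ι ι (PowerSeries ℂ) :=
  (pencilMatrix A B).map (germ z)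

theorem pencilGerm_apply {ι : Type*} (A B : Matrix ι ι ℂ) (z : ℂ) (i j : ι) :
    pencilGerm A B z i j =
      PowerSeries.C (A i j) + (PowerSeries.X + PowerSeries.C z) * PowerSeries.C (B i j) := by
  simp [pencilGerm, pencilMatrix, germ_C, germ_X]
  exact mul_comm _ _

theorem det_submatrix_pencilGerm {ι κ : Type*} [Fintype κ] [DecidableEq κ] (A B : Matrix ι ι ℂ)
    (z : ℂ) (f g : κ → ι) :
    ((pencilGerm A B z).submatrix f g).det = germ z ((pencilMatrix A B).submatrix f g).det := by
  rw [RingHom.map_det]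
  rfl

theorem minorOrder_eq_minOrder (n k : ℕ) (A B : Matrix (Fin n) (Fin n) ℂ) (z : ℂ) :
    minorOrder n k A B z = minOrder k (pencilGerm A B z) := by
  refine le_antisymm (le_iInf₂ fun f g => ?_) (le_iInf₂ fun f g => ?_)
  · by_cases hdet : ((pencilGerm A B z).submatrix f g).det = 0
    · simp [hdet]
    have hf : Function.Injective f := by
      intro i j hij
      by_contra hne
      exact hdet (Matrix.det_zero_of_row_eq hne (by ext1 l; simp [hij]))
    have hg : Function.Injective g := by
      intro i j hij
      by_contra hne
      exact hdet (Matrix.det_zero_of_column_eq hne (by intro l; simp [hij]))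
    refine (iInf₂_le (⟨f, hf⟩ : Fin k ↪ Fin n) (⟨g, hg⟩ : Fin k ↪ Fin n)).trans ?_
    rw [orderVan_eq_order, det_submatrix_pencilGerm]
    rfl
  · rw [orderVan_eq_order]
    exact (minOrder_le _ f g).trans_eq (by rw [det_submatrix_pencilGerm]; rfl)

theorem pencilGerm_transpose {ι : Type*} {A B : Matrix ι ι ℂ} (hA : Aᵀ = -A) (hB : Bᵀ = -B)
    (z : ℂ) : (pencilGerm A B z)ᵀ = -pencilGerm A B z := by
  ext1 i j
  have h1 : A j i = -A i j := congrFun (congrFun hA i) j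
  have h2 : B j i = -B i j := congrFun (congrFun hB i) j
  rw [Matrix.transpose_apply, Matrix.neg_apply, pencilGerm_apply, pencilGerm_apply, h1, h2]
  simp only [map_neg]
  ring

theorem pencilGerm_add {ι : Type*} (A B A' B' : Matrix ι ι ℂ) (z : ℂ) :
    pencilGerm (A + A') (B + B') z = pencilGerm A B z + pencilGerm A' B' z := by
  ext1 i j
  simp only [pencilGerm_apply, Matrix.add_apply, map_add]
  ring

theorem pencilGerm_sum_skewPair {ι σ : Type*} (s : Finset σ) (v γ δ : σ → ι → ℂ) (z : ℂ) :
    pencilGerm (∑ j ∈ s, skewPair (v j) (γ j)) (∑ j ∈ s, skewPair (v j) (δ j)) z =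
      ∑ j ∈ s, skewPair (fun i => PowerSeries.C (v j i)) (fun i =>
        PowerSeries.C (γ j i) + (PowerSeries.X + PowerSeries.C z) * PowerSeries.C (δ j i)) := by
  ext1 i i'
  simp only [pencilGerm_apply, Matrix.sum_apply, skewPair, Matrix.sub_apply,
    Matrix.vecMulVec_apply, map_sum, map_sub, map_mul, Finset.mul_sum, ← Finset.sum_add_distrib]
  refine Finset.sum_congr rfl fun j _ => ?_
  ring

theorem minOrder_eq_order_det {n : ℕ} (M : Matrix (Fin n) (Fin n) (PowerSeries ℂ)) :
    minOrder n M = M.det.order := by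
  refine le_antisymm (minOrder_le M id id) (le_iInf₂ fun f g => ?_)
  rw [← mem_orderIdeal]
  by_cases hdet : (M.submatrix f g).det = 0
  · rw [hdet]
    exact Ideal.zero_mem _
  have hf : Function.Injective f := by
    intro i j hij
    by_contra hne
    exact hdet (Matrix.det_zero_of_row_eq hne (by ext1 l; simp [hij]))
  have hg : Function.Injective g := by
    intro i j hij
    by_contra hne
    exact hdet (Matrix.det_zero_of_column_eq hne (by intro l; simp [hij]))
  obtain ⟨f, rfl⟩ : ∃ σ : Equiv.Perm (Fin n), ⇑σ = f :=
    ⟨Equiv.ofBijective f (Finite.injective_iff_bijective.mp hf), rfl⟩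
  obtain ⟨g, rfl⟩ : ∃ σ : Equiv.Perm (Fin n), ⇑σ = g :=
    ⟨Equiv.ofBijective g (Finite.injective_iff_bijective.mp hg), rfl⟩
  have h : M.submatrix f g = (M.submatrix f id).submatrix id g := rfl
  rw [h, Matrix.det_permute', Matrix.det_permute]
  exact Ideal.mul_mem_left _ _ (Ideal.mul_mem_left _ _ (mem_orderIdeal.mpr le_rfl))

theorem even_of_det_ne_zero {n : ℕ} {M : Matrix (Fin n) (Fin n) (PowerSeries ℂ)}
    (hM : Mᵀ = -M) (hdet : M.det ≠ 0) : Even n := by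
  by_contra hn
  have h := congrArg Matrix.det hM
  rw [Matrix.det_transpose, Matrix.det_neg, Fintype.card_fin,
    (Nat.not_even_iff_odd.mp hn).neg_one_pow, neg_one_mul] at h
  exact hdet (PowerSeries.ext fun c => self_eq_neg.mp (by
    simpa using congrArg (PowerSeries.coeff c) h))

theorem exists_exponents {n : ℕ} {M : Matrix (Fin n) (Fin n) (PowerSeries ℂ)}
    (hM : Mᵀ = -M) (hdet : M.det ≠ 0) :
    ∃ e : ℕ → ℕ, (∀ j k, j ≤ k → k < n → e j ≤ e k) ∧
      (∀ s, 2 * s + 1 < n → e (2 * s + 1) = e (2 * s)) ∧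
      ∀ k ≤ n, minOrder k M = ((∑ i ∈ Finset.range k, e i : ℕ) : ℕ∞) := by
  obtain ⟨e, hmono, hpair, hstep, -⟩ := exists_skew_invariants M hM
  have hfin : ∀ k ≤ n, minOrder k M ≠ ⊤ := by
    intro k hk
    have h1 : minOrder k M ≤ M.det.order := (minOrder_mono M hk).trans_eq (minOrder_eq_order_det M)
    exact ne_top_of_le_ne_top (by rwa [Ne, PowerSeries.order_eq_top]) h1
  have hefin : ∀ k < n, ((e k).toNat : ℕ∞) = e k := by
    intro k hk
    refine ENat.natCast_toNat fun h => hfin (k + 1) hk ?_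
    rw [hstep, h, add_top]
  refine ⟨fun k => (e k).toNat, fun j k hjk hk => ?_, fun s hs => ?_, fun k hk => ?_⟩
  · rw [← Nat.cast_le (α := ℕ∞), hefin k hk, hefin j (by omega)]
    exact hmono hjk
  · simp only [hpair]
  · induction k with
    | zero => simp [minOrder_zero]
    | succ k ih =>
      rw [hstep, ih (by omega), Finset.sum_range_succ, Nat.cast_add, hefin k (by omega)]

theorem pmFin_eq_of_minOrder {n : ℕ} {A B : Matrix (Fin n) (Fin n) ℂ} {z : ℂ} {e : ℕ → ℕ}
    (he : ∀ k ≤ n, minOrder k (pencilGerm A B z) = ((∑ i ∈ Finset.range k, e i : ℕ) : ℕ∞)) :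
    pmFin n A B z = ((Multiset.range n).map e).filter (fun m => 0 < m) := by
  unfold pmFin
  congr 1
  refine Multiset.map_congr rfl fun k hk => ?_
  have hk : k < n := Multiset.mem_range.mp hk
  rw [minorOrder_eq_minOrder, minorOrder_eq_minOrder, he _ hk, he _ hk.le, Finset.sum_range_succ,
    ← ENat.natCast_sub, ENat.toNat_natCast]
  omega

theorem pencilGerm_det {n : ℕ} (A B : Matrix (Fin n) (Fin n) ℂ) (z : ℂ) :
    (pencilGerm A B z).det = germ z (pencilPoly n A B) :=
  det_submatrix_pencilGerm A B z id id

theorem pencilGerm_det_ne_zero {n : ℕ} {A B : Matrix (Fin n) (Fin n) ℂ}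
    (h : PencilRegular n A B) (z : ℂ) : (pencilGerm A B z).det ≠ 0 := by
  rw [pencilGerm_det, Ne, ← PowerSeries.order_eq_top, ← orderVan_eq_order, orderVan, if_neg h]
  exact ENat.natCast_ne_top _

theorem rootMultiplicity_eq_sum {n : ℕ} {A B : Matrix (Fin n) (Fin n) ℂ} {z : ℂ} {e : ℕ → ℕ}
    (h : PencilRegular n A B)
    (he : ∀ k ≤ n, minOrder k (pencilGerm A B z) = ((∑ i ∈ Finset.range k, e i : ℕ) : ℕ∞)) :
    (pencilPoly n A B).rootMultiplicity z = ∑ i ∈ Finset.range n, e i := by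
  have h1 := he n le_rfl
  rw [minOrder_eq_order_det, pencilGerm_det, ← orderVan_eq_order, orderVan, if_neg h] at h1
  exact_mod_cast h1

theorem even_rootMultiplicity {n : ℕ} {A B : Matrix (Fin n) (Fin n) ℂ} (hA : Aᵀ = -A)
    (hB : Bᵀ = -B) (h : PencilRegular n A B) (z : ℂ) :
    Even ((pencilPoly n A B).rootMultiplicity z) := by
  have hdet := pencilGerm_det_ne_zero h z
  have hskew := pencilGerm_transpose hA hB z
  obtain ⟨e, -, hpair, he⟩ := exists_exponents hskew hdet
  obtain ⟨m, hm⟩ := even_of_det_ne_zero hskew hdet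
  rw [rootMultiplicity_eq_sum h he]
  have key : ∀ s, s + s ≤ n → Even (∑ i ∈ Finset.range (s + s), e i) := by
    intro s hs
    induction s with
    | zero => simp
    | succ s ih =>
      rw [show s + 1 + (s + 1) = s + s + 1 + 1 by ring, Finset.sum_range_succ,
        Finset.sum_range_succ, add_assoc]
      refine (ih (by omega)).add ⟨e (s + s), ?_⟩
      have := hpair s (by omega)
      rw [two_mul] at this
      rw [this]
  rw [hm]
  exact key m hm.ge

theorem pmFin_ne_zero_iff {n : ℕ} {A B : Matrix (Fin n) (Fin n) ℂ} (hA : Aᵀ = -A)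
    (hB : Bᵀ = -B) (h : PencilRegular n A B) (z : ℂ) :
    pmFin n A B z ≠ 0 ↔ (pencilPoly n A B).rootMultiplicity z ≠ 0 := by
  obtain ⟨e, -, -, he⟩ := exists_exponents (pencilGerm_transpose hA hB z)
    (pencilGerm_det_ne_zero h z)
  rw [rootMultiplicity_eq_sum h he, pmFin_eq_of_minOrder he, not_iff_not, Finset.sum_eq_zero_iff,
    Multiset.filter_eq_nil]
  simp

end Germ

section Multiplicities

theorem filter_pos_map_range {f : ℕ → ℕ} {g n : ℕ} (hpos : ∀ j, 0 < f j ↔ j < g) (hgn : g ≤ n) :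
    ((Multiset.range n).map f).filter (fun m => 0 < m) = (Multiset.range g).map f := by
  obtain ⟨d, rfl⟩ := Nat.exists_eq_add_of_le hgn
  rw [Multiset.range_add, Multiset.map_add, Multiset.filter_add, Multiset.filter_eq_self.mpr,
    Multiset.filter_eq_nil.mpr, add_zero]
  · simp only [Multiset.map_map, Multiset.mem_map, Multiset.mem_range, Function.comp_apply]
    rintro _ ⟨a, -, rfl⟩
    rw [hpos]
    omega
  · simp [hpos]

theorem map_range_eq_filter_pos_add {f : ℕ → ℕ} {n : ℕ} (s : Multiset ℕ)
    (hs : ((Multiset.range n).map f).filter (fun m => 0 < m) = s) :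
    (Multiset.range n).map f = s + Multiset.replicate (n - s.card) 0 := by
  have h := Multiset.filter_add_not (fun m => 0 < m) ((Multiset.range n).map f)
  rw [hs] at h
  rw [← h]
  congr 1
  rw [Multiset.eq_replicate]
  refine ⟨?_, fun b hb => by simpa using (Multiset.mem_filter.mp hb).2⟩
  have hc := congrArg Multiset.card h
  rw [Multiset.card_add, Multiset.card_map, Multiset.card_range] at hc
  omega

theorem eq_reverse_of_filter_pos {e f : ℕ → ℕ} {g n : ℕ} (he : ∀ j k, j ≤ k → k < n → e j ≤ e k)
    (hf : ∀ j k, j ≤ k → f k ≤ f j) (hpos : ∀ j, 0 < f j ↔ j < g) (hgn : g ≤ n)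
    (hs : ((Multiset.range n).map e).filter (fun m => 0 < m) = (Multiset.range g).map f) :
    (List.range n).map f = ((List.range n).map e).reverse := by
  have h1 := map_range_eq_filter_pos_add _ hs
  rw [← map_range_eq_filter_pos_add _ (filter_pos_map_range hpos hgn)] at h1
  have hperm : ((List.range n).map f).Perm ((List.range n).map e).reverse := by
    rw [List.perm_comm]
    refine (List.reverse_perm _).trans ?_
    rw [← Multiset.coe_eq_coe]
    exact h1
  refine hperm.eq_of_pairwise (le := (· ≥ ·)) (fun a b _ _ h h' => le_antisymm h' h) ?_ ?_
  · rw [List.pairwise_map]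
    exact List.pairwise_lt_range.imp fun h => hf _ _ h.le
  · rw [List.pairwise_reverse, List.pairwise_map]
    refine List.Pairwise.imp_of_mem ?_ (List.pairwise_lt_range (n := n))
    intro a b _ hb hab
    exact he a b hab.le (List.mem_range.mp hb)

theorem filter_pos_map_range_sub {e f : ℕ → ℕ} {g n : ℕ} (he : ∀ j k, j ≤ k → k < n → e j ≤ e k)
    (hf : ∀ j k, j ≤ k → f k ≤ f j) (hpos : ∀ j, 0 < f j ↔ j < g)
    (hs : ((Multiset.range n).map e).filter (fun m => 0 < m) = (Multiset.range g).map f) (r : ℕ) :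
    ((Multiset.range (n - r)).map e).filter (fun m => 0 < m) =
      (Multiset.range (g - r)).map fun j => f (r + j) := by
  have hgn : g ≤ n := by
    have h1 := congrArg Multiset.card hs
    have h2 := Multiset.card_le_card (Multiset.filter_le (fun m => 0 < m)
      ((Multiset.range n).map e))
    simp only [Multiset.card_map, Multiset.card_range] at h1 h2
    omega
  have hrev := eq_reverse_of_filter_pos he hf hpos hgn hs
  have hval : ∀ j, j < n → f j = e (n - 1 - j) := by
    intro j hj
    have h := congrArg (fun l : List ℕ => l[j]?) hrev
    simpa [hj, List.getElem?_reverse, show n - 1 - j < n by omega] using h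
  have hlist : (List.range (n - r)).map (fun j => f (r + j)) =
      ((List.range (n - r)).map e).reverse := by
    refine List.ext_getElem (by simp) fun j hj _ => ?_
    simp only [List.length_map, List.length_range] at hj
    simp only [List.getElem_map, List.getElem_range, List.getElem_reverse, List.length_map,
      List.length_range]
    rw [hval _ (by omega)]
    congr 1
    omega
  have hmap : (Multiset.range (n - r)).map e = (Multiset.range (n - r)).map fun j => f (r + j) := by
    refine Multiset.coe_eq_coe.mpr ?_
    rw [hlist]
    exact (List.reverse_perm _).symm
  rw [hmap]
  exact filter_pos_map_range (fun j => by rw [hpos]; omega) (by omega)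

theorem filter_pos_map_range_of_shift {e e' : ℕ → ℕ} {n r : ℕ} (hn : Even n) (hr : Even r)
    (hpair : ∀ s, 2 * s + 1 < n → e (2 * s + 1) = e (2 * s))
    (hpair' : ∀ s, 2 * s + 1 < n → e' (2 * s + 1) = e' (2 * s))
    (hsum : ∀ k ≤ n, Even k →
      ∑ i ∈ Finset.range k, e' i = ∑ i ∈ Finset.range (k - r), e i) :
    ((Multiset.range n).map e').filter (fun m => 0 < m) =
      ((Multiset.range (n - r)).map e).filter (fun m => 0 < m) := by
  obtain ⟨m, rfl⟩ := hn
  obtain ⟨t, rfl⟩ := hr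
  have hpairs : ∀ s, s < m → e' (2 * s) = if s < t then 0 else e (2 * (s - t)) := by
    intro s hs
    have h1 := hsum (2 * s) (by omega) (even_two_mul s)
    have h2 := hsum (2 * s + 1 + 1) (by omega) ⟨s + 1, by ring⟩
    rw [Finset.sum_range_succ, Finset.sum_range_succ, hpair' s (by omega), h1] at h2
    split_ifs with hst
    · rw [show 2 * s - (t + t) = 0 by omega, show 2 * s + 1 + 1 - (t + t) = 0 by omega] at h2
      omega
    · rw [show 2 * s - (t + t) = 2 * (s - t) by omega,
        show 2 * s + 1 + 1 - (t + t) = 2 * (s - t) + 1 + 1 by omega, Finset.sum_range_succ,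
        Finset.sum_range_succ, hpair (s - t) (by omega)] at h2
      omega
  have hval : ∀ k, k < m + m → e' k = if k < t + t then 0 else e (k - (t + t)) := by
    intro k hk
    rcases Nat.even_or_odd' k with ⟨s, rfl | rfl⟩
    · rw [hpairs s (by omega), show 2 * s - (t + t) = 2 * (s - t) by omega]
      simp only [show (2 * s < t + t) ↔ s < t by omega]
    · rw [hpair' s (by omega), hpairs s (by omega)]
      simp only [show (2 * s + 1 < t + t) ↔ s < t by omega]
      split_ifs with hst
      · rfl
      · rw [show 2 * s + 1 - (t + t) = 2 * (s - t) + 1 by omega, hpair (s - t) (by omega)]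
  rcases le_total m t with hmt | hmt
  · rw [show m + m - (t + t) = 0 by omega, Multiset.filter_eq_nil.mpr]
    · simp
    · intro a ha
      obtain ⟨k, hk, rfl⟩ := Multiset.mem_map.mp ha
      rw [Multiset.mem_range] at hk
      rw [hval k hk, if_pos (by omega)]
      exact lt_irrefl 0
  · obtain ⟨d, rfl⟩ := Nat.exists_eq_add_of_le hmt
    rw [show t + d + (t + d) = t + t + (d + d) by ring, Nat.add_sub_cancel_left,
      Multiset.range_add, Multiset.map_add, Multiset.filter_add, Multiset.filter_eq_nil.mpr,
      zero_add, Multiset.map_map]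
    · congr 1
      refine Multiset.map_congr rfl fun k hk => ?_
      rw [Multiset.mem_range] at hk
      rw [Function.comp_apply, hval _ (by omega), if_neg (by omega), Nat.add_sub_cancel_left]
    · intro a ha
      obtain ⟨k, hk, rfl⟩ := Multiset.mem_map.mp ha
      rw [Multiset.mem_range] at hk
      rw [hval k (by omega), if_pos (by omega)]
      exact lt_irrefl 0

theorem pmFin_of_minOrder_shift {n r g : ℕ} (hr : Even r) {A B A' B' : Matrix (Fin n) (Fin n) ℂ}
    {z : ℂ} (hA : Aᵀ = -A) (hB : Bᵀ = -B) (hA' : A'ᵀ = -A') (hB' : B'ᵀ = -B')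
    (hreg : PencilRegular n A B) (hreg' : PencilRegular n A' B') {f : ℕ → ℕ}
    (hf : ∀ j k, j ≤ k → f k ≤ f j) (hpos : ∀ j, 0 < f j ↔ j < g)
    (hpm : pmFin n A B z = (Multiset.range g).map f)
    (hshift : ∀ k ≤ n, Even k →
      minOrder k (pencilGerm A' B' z) = minOrder (k - r) (pencilGerm A B z)) :
    pmFin n A' B' z = (Multiset.range (g - r)).map fun j => f (r + j) := by
  have hskew := pencilGerm_transpose hA hB z
  have hdet := pencilGerm_det_ne_zero hreg z
  obtain ⟨e, hmono, hpair, he⟩ := exists_exponents hskew hdet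
  obtain ⟨e', -, hpair', he'⟩ := exists_exponents (pencilGerm_transpose hA' hB' z)
    (pencilGerm_det_ne_zero hreg' z)
  rw [pmFin_eq_of_minOrder he] at hpm
  rw [pmFin_eq_of_minOrder he', filter_pos_map_range_of_shift (even_of_det_ne_zero hskew hdet) hr
    hpair hpair', filter_pos_map_range_sub hmono hf hpos hpm]
  intro k hk hke
  have h := hshift k hk hke
  rw [he' k hk, he _ (by omega)] at h
  exact_mod_cast h

end Multiplicities

section Generic

/-- A property of points of `ι → ℂ` that holds wherever some fixed nonzero polynomial does not
vanish. -/
def Generically {ι : Type*} (P : (ι → ℂ) → Prop) : Prop :=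
  ∃ p : MvPolynomial ι ℂ, p ≠ 0 ∧ ∀ x, MvPolynomial.eval x p ≠ 0 → P x

theorem Generically.mono {ι : Type*} {P Q : (ι → ℂ) → Prop} (hP : Generically P)
    (h : ∀ x, P x → Q x) : Generically Q := by
  obtain ⟨p, hp, hx⟩ := hP
  exact ⟨p, hp, fun x hpx => h x (hx x hpx)⟩

theorem Generically.of_forall {ι : Type*} {P : (ι → ℂ) → Prop} (h : ∀ x, P x) : Generically P :=
  ⟨1, one_ne_zero, fun x _ => h x⟩

theorem Generically.and {ι : Type*} {P Q : (ι → ℂ) → Prop} (hP : Generically P)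
    (hQ : Generically Q) : Generically fun x => P x ∧ Q x := by
  obtain ⟨p, hp, hpx⟩ := hP
  obtain ⟨q, hq, hqx⟩ := hQ
  refine ⟨p * q, mul_ne_zero hp hq, fun x hx => ?_⟩
  rw [map_mul] at hx
  exact ⟨hpx x (left_ne_zero_of_mul hx), hqx x (right_ne_zero_of_mul hx)⟩

theorem Generically.forall_fintype {ι σ : Type*} [Fintype σ] {P : σ → (ι → ℂ) → Prop}
    (h : ∀ s, Generically (P s)) : Generically fun x => ∀ s, P s x := by
  choose p hp hx using h
  refine ⟨∏ s, p s, Finset.prod_ne_zero_iff.mpr fun s _ => hp s, fun x hpx s => hx s x ?_⟩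
  rw [map_prod] at hpx
  exact Finset.prod_ne_zero_iff.mp hpx s (Finset.mem_univ s)

theorem Generically.comp_equiv {ι : Type*} {P : (ι → ℂ) → Prop} (h : Generically P) (e : ι ≃ ι) :
    Generically fun x => P (x ∘ e) := by
  obtain ⟨p, hp, hx⟩ := h
  refine ⟨MvPolynomial.rename e p,
    (map_ne_zero_iff _ (MvPolynomial.rename_injective e e.injective)).mpr hp, fun x hpx => ?_⟩
  rw [MvPolynomial.eval_rename] at hpx
  exact hx _ hpx

theorem Generically.isGenericC {ι : Type} [Fintype ι] {P : (ι → ℂ) → Prop} (h : Generically P) :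
    IsGenericC ι {x | P x} := by
  obtain ⟨p, hp, hx⟩ := h
  refine ⟨{p}, ⟨p, Finset.mem_singleton_self p, hp⟩, fun x hxP q hq => ?_⟩
  rw [Finset.mem_singleton.mp hq]
  by_contra hne
  exact hxP (hx x hne)

theorem generically_minOrder_le {ι : Type*} {n k : ℕ}
    (F H : Matrix (Fin n) (Fin n) (MvPolynomial ι ℂ)) (z : ℂ) (c : ℕ∞) (x₀ : ι → ℂ)
    (h : minOrder k (pencilGerm (F.map (MvPolynomial.eval x₀)) (H.map (MvPolynomial.eval x₀)) z) ≤
      c) :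
    Generically fun x =>
      minOrder k (pencilGerm (F.map (MvPolynomial.eval x)) (H.map (MvPolynomial.eval x)) z) ≤
        c := by
  rcases eq_or_ne c ⊤ with rfl | hc
  · exact Generically.of_forall fun x => le_top
  rw [← ENat.lt_add_one_iff hc, minOrder] at h
  simp only [iInf_lt_iff] at h
  obtain ⟨f, g, hfg⟩ := h
  rw [ENat.lt_add_one_iff hc] at hfg
  set D : Polynomial (MvPolynomial ι ℂ) := ((pencilMatrix F H).submatrix f g).det with hD
  have hcoeff : ∀ (x : ι → ℂ) (d : ℕ), PowerSeries.coeff d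
      ((pencilGerm (F.map (MvPolynomial.eval x)) (H.map (MvPolynomial.eval x)) z).submatrix
        f g).det =
      MvPolynomial.eval x ((Polynomial.taylor (MvPolynomial.C z) D).coeff d) := by
    intro x d
    rw [det_submatrix_pencilGerm, coeff_germ, ← Polynomial.coeff_map, Polynomial.map_taylor,
      MvPolynomial.eval_C, ← pencilMatrix_map, hD, ← Polynomial.coe_mapRingHom, RingHom.map_det]
    rfl
  obtain ⟨d, hd⟩ := ENat.ne_top_iff_exists.mp (ne_top_of_le_ne_top hc hfg)
  refine ⟨(Polynomial.taylor (MvPolynomial.C z) D).coeff d, fun h0 => ?_, fun x hx => ?_⟩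
  · have h1 := (PowerSeries.order_eq_nat.mp hd.symm).1
    rw [hcoeff, h0, map_zero] at h1
    exact h1 rfl
  · rw [← hcoeff] at hx
    exact (minOrder_le _ f g).trans ((PowerSeries.order_le d hx).trans (hd.trans_le hfg))

end Generic

section Phi

variable {R S : Type*} [CommRing R] [CommRing S] {n r : ℕ}

/-- `Σ_j (v_j w_jᵀ - w_j v_jᵀ)` for families of vectors given by their coordinates. -/
def skewSum {q : ℕ} (v w : Fin q × Fin n → R) : Matrix (Fin n) (Fin n) R :=
  ∑ j, skewPair (fun k => v (j, k)) (fun k => w (j, k))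

theorem skewSum_map {q : ℕ} (f : R →+* S) (v w : Fin q × Fin n → R) :
    (skewSum v w).map f = skewSum (f ∘ v) (f ∘ w) := by
  ext i j
  simp [skewSum, skewPair, Matrix.sum_apply, Matrix.vecMulVec_apply]

theorem skewSum_transpose {q : ℕ} (v w : Fin q × Fin n → R) :
    (skewSum v w)ᵀ = -skewSum v w :=
  sum_skewPair_transpose _ _ _

theorem PhiSSA_eq (x : ParamSS r n → ℂ) :
    PhiSSA n r x = skewSum (fun p => x (.inl p)) (fun p => x (.inr (.inl p))) := rfl

theorem PhiSSB_eq (x : ParamSS r n → ℂ) :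
    PhiSSB n r x = skewSum (fun p => x (.inl p)) (fun p => x (.inr (.inr p))) := rfl

/-- The constant coefficient of the perturbed pencil, with indeterminate parameters. -/
noncomputable def genericA (r : ℕ) (A : Matrix (Fin n) (Fin n) ℂ) :
    Matrix (Fin n) (Fin n) (MvPolynomial (ParamSS r n) ℂ) :=
  A.map MvPolynomial.C +
    skewSum (fun p => MvPolynomial.X (.inl p)) (fun p => MvPolynomial.X (.inr (.inl p)))

/-- The linear coefficient of the perturbed pencil, with indeterminate parameters. -/
noncomputable def genericB (r : ℕ) (B : Matrix (Fin n) (Fin n) ℂ) :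
    Matrix (Fin n) (Fin n) (MvPolynomial (ParamSS r n) ℂ) :=
  B.map MvPolynomial.C +
    skewSum (fun p => MvPolynomial.X (.inl p)) (fun p => MvPolynomial.X (.inr (.inr p)))

theorem genericA_map_eval (A : Matrix (Fin n) (Fin n) ℂ) (x : ParamSS r n → ℂ) :
    (genericA r A).map (MvPolynomial.eval x) = A + PhiSSA n r x := by
  rw [genericA, Matrix.map_add _ (map_add _), skewSum_map, PhiSSA_eq]
  congr 1
  · ext; simp
  · congr 1 <;> ext <;> simp

theorem genericB_map_eval (B : Matrix (Fin n) (Fin n) ℂ) (x : ParamSS r n → ℂ) :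
    (genericB r B).map (MvPolynomial.eval x) = B + PhiSSB n r x := by
  rw [genericB, Matrix.map_add _ (map_add _), skewSum_map, PhiSSB_eq]
  congr 1
  · ext; simp
  · congr 1 <;> ext <;> simp

theorem PhiSSA_zero : PhiSSA n r 0 = 0 := by
  ext
  simp [PhiSSA, Matrix.sum_apply]

theorem PhiSSB_zero : PhiSSB n r 0 = 0 := by
  ext
  simp [PhiSSB, Matrix.sum_apply]

theorem add_PhiSSA_transpose {A : Matrix (Fin n) (Fin n) ℂ} (hA : Aᵀ = -A)
    (x : ParamSS r n → ℂ) : (A + PhiSSA n r x)ᵀ = -(A + PhiSSA n r x) := by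
  rw [Matrix.transpose_add, hA, PhiSSA_eq, skewSum_transpose, neg_add]

theorem add_PhiSSB_transpose {B : Matrix (Fin n) (Fin n) ℂ} (hB : Bᵀ = -B)
    (x : ParamSS r n → ℂ) : (B + PhiSSB n r x)ᵀ = -(B + PhiSSB n r x) := by
  rw [Matrix.transpose_add, hB, PhiSSB_eq, skewSum_transpose, neg_add]

theorem generically_regular {A B : Matrix (Fin n) (Fin n) ℂ} (hreg : PencilRegular n A B) :
    Generically fun x : ParamSS r n → ℂ =>
      PencilRegular n (A + PhiSSA n r x) (B + PhiSSB n r x) := by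
  have h := generically_minOrder_le (k := n) (genericA r A) (genericB r B) 0
    (pencilGerm A B 0).det.order 0 (by
      rw [genericA_map_eval, genericB_map_eval, PhiSSA_zero, PhiSSB_zero, add_zero, add_zero,
        minOrder_eq_order_det])
  refine h.mono fun x hx h0 => ?_
  rw [genericA_map_eval, genericB_map_eval, minOrder_eq_order_det, pencilGerm_det, h0, map_zero,
    PowerSeries.order_zero, top_le_iff, PowerSeries.order_eq_top] at hx
  exact pencilGerm_det_ne_zero hreg 0 hx

theorem generically_not_infinite_root {A B : Matrix (Fin n) (Fin n) ℂ}
    (hreg : PencilRegular n B A) (hroot : (pencilPoly n B A).rootMultiplicity 0 = 0) :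
    Generically fun x : ParamSS r n → ℂ =>
      (pencilPoly n (B + PhiSSB n r x) (A + PhiSSA n r x)).rootMultiplicity 0 = 0 := by
  have h := generically_minOrder_le (k := n) (genericB r B) (genericA r A) 0 0 0 (by
    rw [genericA_map_eval, genericB_map_eval, PhiSSA_zero, PhiSSB_zero, add_zero, add_zero,
      minOrder_eq_order_det, pencilGerm_det, ← orderVan_eq_order, orderVan, if_neg hreg, hroot]
    rfl)
  refine h.mono fun x hx => ?_
  rw [genericA_map_eval, genericB_map_eval, minOrder_eq_order_det, pencilGerm_det,
    ← orderVan_eq_order, orderVan] at hx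
  split_ifs at hx with h0
  · rw [h0, Polynomial.rootMultiplicity_zero]
  · simpa using hx

theorem generically_minOrder_shift (hr : Even r) {A B : Matrix (Fin n) (Fin n) ℂ} (hA : Aᵀ = -A)
    (hB : Bᵀ = -B) (z : ℂ) :
    Generically fun x : ParamSS r n → ℂ => ∀ k ≤ n, Even k →
      minOrder k (pencilGerm (A + PhiSSA n r x) (B + PhiSSB n r x) z) =
        minOrder (k - r) (pencilGerm A B z) := by
  have hcard : 2 * (r / 2) = r := Nat.two_mul_div_two_of_even hr
  have key : ∀ k : Fin (n + 1), Generically fun x : ParamSS r n → ℂ => Even (k : ℕ) →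
      minOrder k (pencilGerm (A + PhiSSA n r x) (B + PhiSSB n r x) z) =
        minOrder (k - r) (pencilGerm A B z) := by
    intro k
    by_cases hk : Even (k : ℕ)
    swap
    · exact Generically.of_forall fun x h => absurd h hk
    obtain ⟨v, w, hvw⟩ := exists_sum_skewPair_minOrder_le (pencilGerm A B z)
      (pencilGerm_transpose hA hB z) (r / 2) hk (by omega)
    have h := generically_minOrder_le (k := k) (genericA r A) (genericB r B) z
      (minOrder (k - r) (pencilGerm A B z))
      (Sum.elim (fun p => v p.1 p.2) (Sum.elim (fun p => w p.1 p.2) 0)) (by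
        rw [hcard] at hvw
        rw [genericA_map_eval, genericB_map_eval, pencilGerm_add]
        refine le_of_eq_of_le ?_ hvw
        congr 2
        ext1 i j
        simp [pencilGerm_apply, PhiSSA, PhiSSB, skewPair, Matrix.sum_apply,
          Matrix.vecMulVec_apply])
    refine h.mono fun x hx _ => le_antisymm ?_ ?_
    · rwa [genericA_map_eval, genericB_map_eval] at hx
    · rw [pencilGerm_add, PhiSSA_eq, PhiSSB_eq, skewSum, skewSum, pencilGerm_sum_skewPair]
      refine le_of_eq_of_le ?_ (minOrder_le_add_sum_skewPair Finset.univ _ _ _ _)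
      rw [Finset.card_fin, hcard]
  refine (Generically.forall_fintype key).mono fun x hx k hk => ?_
  exact hx ⟨k, by omega⟩

theorem generically_minOrder_reverse_shift (hr : Even r) {A B : Matrix (Fin n) (Fin n) ℂ}
    (hA : Aᵀ = -A) (hB : Bᵀ = -B) (z : ℂ) :
    Generically fun x : ParamSS r n → ℂ => ∀ k ≤ n, Even k →
      minOrder k (pencilGerm (B + PhiSSB n r x) (A + PhiSSA n r x) z) =
        minOrder (k - r) (pencilGerm B A z) := by
  exact (generically_minOrder_shift hr hB hA z).comp_equiv
    ((Equiv.refl _).sumCongr (Equiv.sumComm _ _))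

end Phi

section PrimeFactor

variable {R : Type*} [CommRing R] [IsDomain R]

theorem exists_prime_dvd_of_mem [UniqueFactorizationMonoid R] {𝔭 : Ideal (Polynomial R)}
    (h𝔭 : 𝔭.IsPrime) (hbot : 𝔭 ≠ ⊥) (hconst : ∀ a : R, Polynomial.C a ∈ 𝔭 → a = 0) :
    ∃ p : Polynomial R, Prime p ∧ p ∈ 𝔭 ∧ ∀ f ∈ 𝔭, p ∣ f := by
  classical
  have hex : ∃ d : ℕ, ∃ f ∈ 𝔭, f ≠ 0 ∧ f.natDegree = d := by
    obtain ⟨f, hf, hf0⟩ := Submodule.exists_mem_ne_zero_of_ne_bot hbot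
    exact ⟨_, f, hf, hf0, rfl⟩
  obtain ⟨f₀, hf₀, hne, hdeg⟩ := Nat.find_spec hex
  have hmin : ∀ f ∈ 𝔭, f ≠ 0 → f₀.natDegree ≤ f.natDegree := fun f hf hf0 =>
    hdeg.trans_le (Nat.find_min' hex ⟨f, hf, hf0, rfl⟩)
  obtain ⟨s, hs, hprod⟩ := UniqueFactorizationMonoid.exists_prime_factors f₀ hne
  obtain ⟨p, hps, hp⟩ := (h𝔭.multiset_prod_mem_iff_exists_mem s).mp
    (Ideal.mem_of_dvd 𝔭 hprod.symm.dvd hf₀)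
  have hpdvd : p ∣ f₀ := (Multiset.dvd_prod hps).trans hprod.dvd
  have hple : p.natDegree ≤ f₀.natDegree := Polynomial.natDegree_le_of_dvd hpdvd hne
  refine ⟨p, hs p hps, hp, ?_⟩
  have hprime := hs p hps
  intro f
  induction hd : f.natDegree using Nat.strong_induction_on generalizing f with
  | _ d ih =>
    intro hf
    rcases eq_or_ne f 0 with rfl | hf0
    · exact dvd_zero p
    have hpf : p.natDegree ≤ f.natDegree := hple.trans (hmin f hf hf0)
    have hfpos : 0 < f.natDegree := by
      rw [Nat.pos_iff_ne_zero]
      intro h0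
      obtain ⟨a, rfl⟩ := Polynomial.natDegree_eq_zero.mp h0
      exact hf0 (by rw [hconst a hf, map_zero])
    have hlt := Polynomial.natDegree_cancelLeads_lt_of_natDegree_le_natDegree hpf hfpos
    have hmem : p.cancelLeads f ∈ 𝔭 :=
      Ideal.sub_mem _ (Ideal.mul_mem_left _ _ hf) (Ideal.mul_mem_left _ _ hp)
    have hdvd := ih _ (hd ▸ hlt) _ rfl hmem
    rw [Polynomial.cancelLeads, Nat.sub_eq_zero_of_le hpf, pow_zero, mul_one,
      dvd_sub_left (Dvd.intro_left _ rfl)] at hdvd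
    refine (hprime.dvd_or_dvd hdvd).resolve_left fun h => hprime.ne_zero ?_
    exact Polynomial.leadingCoeff_eq_zero.mp (hconst _ (Ideal.mem_of_dvd 𝔭 h hp))

theorem cube_dvd_of_dvd_derivative [CharZero R] {p D : Polynomial R} (hp : Prime p)
    (hdeg : p.natDegree ≠ 0) (h0 : p ∣ D) (h1 : p ∣ Polynomial.derivative D)
    (h2 : p ∣ Polynomial.derivative (Polynomial.derivative D)) : p ^ 3 ∣ D := by
  have hder : ¬p ∣ Polynomial.derivative p := by
    intro h
    rcases eq_or_ne (Polynomial.derivative p) 0 with hz | hz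
    · exact hdeg (Polynomial.derivative_eq_zero.mp hz)
    · exact absurd (Polynomial.natDegree_le_of_dvd h hz)
        (not_le.mpr (Polynomial.natDegree_derivative_lt hdeg))
  obtain ⟨q, rfl⟩ := h0
  rw [Polynomial.derivative_mul, dvd_add_left (Dvd.intro _ rfl)] at h1
  obtain ⟨s, rfl⟩ := (hp.dvd_or_dvd h1).resolve_left hder
  have h3 : p ∣ 2 * (Polynomial.derivative p * (Polynomial.derivative p * s)) := by
    have heq : Polynomial.derivative (Polynomial.derivative (p * (p * s))) =
        2 * (Polynomial.derivative p * (Polynomial.derivative p * s)) +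
          p * (2 * Polynomial.derivative (Polynomial.derivative p) * s +
            4 * Polynomial.derivative p * Polynomial.derivative s +
            p * Polynomial.derivative (Polynomial.derivative s)) := by
      simp only [Polynomial.derivative_mul, Polynomial.derivative_add]
      ring
    rw [heq, dvd_add_left (Dvd.intro _ rfl)] at h2
    exact h2
  have htwo : ¬p ∣ (2 : Polynomial R) := by
    intro h
    have := Polynomial.natDegree_le_of_dvd h two_ne_zero
    rw [Polynomial.natDegree_ofNat] at this
    omega
  have h4 := (hp.dvd_or_dvd ((hp.dvd_or_dvd ((hp.dvd_or_dvd h3).resolve_left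
    htwo)).resolve_left hder)).resolve_left hder
  obtain ⟨t, rfl⟩ := h4
  exact ⟨t, by ring⟩

end PrimeFactor

section Degree

theorem degreeOf_det_le {m σ : Type*} [Fintype m] [DecidableEq m]
    (N : Matrix m m (MvPolynomial σ ℂ)) (i : σ) (d : m → ℕ)
    (h : ∀ a c, MvPolynomial.degreeOf i (N a c) ≤ d c) :
    MvPolynomial.degreeOf i N.det ≤ ∑ c, d c := by
  rw [Matrix.det_apply]
  refine (MvPolynomial.degreeOf_sum_le _ _ _).trans (Finset.sup_le fun τ _ => ?_)
  have hprod : MvPolynomial.degreeOf i (∏ c, N (τ c) c) ≤ ∑ c, d c :=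
    (MvPolynomial.degreeOf_prod_le _ _ _).trans (Finset.sum_le_sum fun c _ => h _ _)
  rcases Int.units_eq_one_or (Equiv.Perm.sign τ) with hs | hs
  · rwa [hs, one_smul]
  · rwa [hs, Units.neg_smul, one_smul, MvPolynomial.degreeOf_neg]

theorem skewSum_eq_mul {n q : ℕ} {R : Type*} [CommRing R] (v w : Fin q × Fin n → R) :
    skewSum v w =
      (Matrix.of fun k (c : Fin q ⊕ Fin q) => Sum.elim (fun j => v (j, k)) (fun j => w (j, k)) c) *
      (Matrix.of fun (c : Fin q ⊕ Fin q) k =>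
        Sum.elim (fun j => w (j, k)) (fun j => -v (j, k)) c) := by
  ext k l
  simp [skewSum, skewPair, Matrix.sum_apply, Matrix.vecMulVec_apply, Matrix.mul_apply,
    sub_eq_add_neg, Finset.sum_add_distrib]

/-- The perturbed pencil, with indeterminate parameters and eigenvalue parameter. -/
noncomputable def genericPencil {n : ℕ} (r : ℕ) (A B : Matrix (Fin n) (Fin n) ℂ) :
    Matrix (Fin n) (Fin n) (MvPolynomial (Option (ParamSS r n)) ℂ) :=
  A.map MvPolynomial.C + (MvPolynomial.X none : MvPolynomial (Option (ParamSS r n)) ℂ) •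
    B.map MvPolynomial.C +
    skewSum (fun p => MvPolynomial.X (some (.inl p)))
      (fun p => MvPolynomial.X (some (.inr (.inl p))) +
        MvPolynomial.X none * MvPolynomial.X (some (.inr (.inr p))))

theorem skewPair_add_smul {ι R : Type*} [CommRing R] (v w w' : ι → R) (t : R) :
    skewPair v (fun i => w i + t * w' i) = skewPair v w + t • skewPair v w' := by
  ext i j
  simp only [skewPair, Matrix.sub_apply, Matrix.add_apply, Matrix.smul_apply,
    Matrix.vecMulVec_apply, smul_eq_mul]
  ring

theorem skewSum_add_smul {n q : ℕ} {R : Type*} [CommRing R] (v w w' : Fin q × Fin n → R) (t : R) :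
    skewSum v (fun p => w p + t * w' p) = skewSum v w + t • skewSum v w' := by
  rw [skewSum, skewSum, skewSum, Finset.smul_sum, ← Finset.sum_add_distrib]
  exact Finset.sum_congr rfl fun j _ => skewPair_add_smul _ _ _ _

theorem genericPencil_map {n r : ℕ} (A B : Matrix (Fin n) (Fin n) ℂ) :
    (genericPencil r A B).map (MvPolynomial.optionEquivLeft ℂ (ParamSS r n) : _ →+* _) =
      pencilMatrix (genericA r A) (genericB r B) := by
  rw [genericPencil, Matrix.map_add _ (map_add _), skewSum_map, pencilMatrix, genericA, genericB,
    Matrix.map_add _ (map_add _), Matrix.map_add _ (map_add _), Matrix.map_add _ (map_add _),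
    skewSum_map, skewSum_map, smul_add, add_add_add_comm, ← skewSum_add_smul]
  refine congrArg₂ (· + ·) ?_ (congrArg₂ skewSum ?_ ?_)
  · ext1 i j
    simp
  · ext1 p
    simp
  · ext1 p
    simp

theorem degreeOf_pencil_entry {σ : Type*} (a b : ℂ) (i : σ) :
    MvPolynomial.degreeOf (some i) (MvPolynomial.C a + MvPolynomial.X none * MvPolynomial.C b :
      MvPolynomial (Option σ) ℂ) = 0 := by
  classical
  refine Nat.le_zero.mp ((MvPolynomial.degreeOf_add_le _ _ _).trans (max_le ?_ ?_))
  · rw [MvPolynomial.degreeOf_C]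
  · refine (MvPolynomial.degreeOf_mul_le _ _ _).trans ?_
    rw [MvPolynomial.degreeOf_C, MvPolynomial.degreeOf_X, if_neg (by simp)]

theorem degreeOf_linear_entry {σ : Type*} [DecidableEq σ] (a b i : σ) (hab : a ≠ b) :
    MvPolynomial.degreeOf (some i) (MvPolynomial.X (some a) + MvPolynomial.X none *
      MvPolynomial.X (some b) : MvPolynomial (Option σ) ℂ) ≤ if i = a ∨ i = b then 1 else 0 := by
  refine (MvPolynomial.degreeOf_add_le _ _ _).trans (max_le ?_ ?_)
  · rw [MvPolynomial.degreeOf_X]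
    simp only [Option.some_inj]
    split_ifs <;> simp_all
  · refine (MvPolynomial.degreeOf_mul_le _ _ _).trans ?_
    rw [MvPolynomial.degreeOf_X, MvPolynomial.degreeOf_X, if_neg (by simp), zero_add]
    simp only [Option.some_inj]
    split_ifs <;> simp_all

theorem degreeOf_det_genericPencil_le {n r : ℕ} (A B : Matrix (Fin n) (Fin n) ℂ)
    (i : ParamSS r n) :
    MvPolynomial.degreeOf (some i) (genericPencil r A B).det ≤ 2 := by
  rw [genericPencil, skewSum_eq_mul, ← sub_neg_eq_add _ (_ * _), ← Matrix.mul_neg,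
    ← Matrix.det_fromBlocks_one₂₂]
  obtain ⟨col, hcol⟩ : ∃ col : Fin n, col = Sum.elim Prod.snd (Sum.elim Prod.snd Prod.snd) i :=
    ⟨_, rfl⟩
  obtain ⟨row, hrow⟩ : ∃ row : Fin (r / 2) ⊕ Fin (r / 2), row =
      Sum.elim (fun p => .inl p.1) (Sum.elim (fun p => .inr p.1) (fun p => .inr p.1)) i :=
    ⟨_, rfl⟩
  have hite : ∀ {P Q : Prop} [Decidable P] [Decidable Q], (P → Q) →
      (if P then 1 else 0) ≤ (if Q then 1 else 0) := by
    intro P Q _ _ h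
    split_ifs <;> simp_all
  refine (degreeOf_det_le _ _ (Sum.elim (fun k => if k = col then 1 else 0)
    (fun c => if c = row then 1 else 0)) ?_).trans ?_
  · rintro (a | a) (c | c)
    · have h := degreeOf_pencil_entry (σ := ParamSS r n) (A a c) (B a c) i
      refine le_of_eq_of_le ?_ zero_le
      simpa using h
    · rcases c with j | j
      · simp only [Matrix.fromBlocks_apply₁₂, Matrix.of_apply, Sum.elim_inl, Sum.elim_inr,
          MvPolynomial.degreeOf_X, Option.some_inj]
        exact hite fun h => by rw [hrow, h]; rfl
      · simp only [Matrix.fromBlocks_apply₁₂, Matrix.of_apply, Sum.elim_inr]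
        exact (degreeOf_linear_entry _ _ _ (by simp)).trans
          (hite fun h => by rcases h with h | h <;> rw [hrow, h] <;> rfl)
    · rcases a with j | j
      · simp only [Matrix.fromBlocks_apply₂₁, Matrix.neg_apply, Matrix.of_apply, Sum.elim_inl,
          MvPolynomial.degreeOf_neg]
        exact (degreeOf_linear_entry _ _ _ (by simp)).trans
          (hite fun h => by rcases h with h | h <;> rw [hcol, h] <;> rfl)
      · simp only [Matrix.fromBlocks_apply₂₁, Matrix.neg_apply, Matrix.of_apply, Sum.elim_inl,
          Sum.elim_inr, MvPolynomial.degreeOf_neg, MvPolynomial.degreeOf_X, Option.some_inj]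
        exact hite fun h => by rw [hcol, h]; rfl
    · rw [Matrix.fromBlocks_apply₂₂, Matrix.one_apply]
      split_ifs <;> simp
  · rw [Fintype.sum_sum_type]
    simp

end Degree

section NewEigenvalues

variable {n r : ℕ}

theorem map_eq_self_of_degreeOf_eq_zero {σ : Type*} {p : MvPolynomial (Option σ) ℂ}
    (hp : ∀ i, MvPolynomial.degreeOf (some i) p = 0) :
    Polynomial.mapRingHom ((MvPolynomial.C (σ := σ)).comp (MvPolynomial.eval 0))
      (MvPolynomial.optionEquivLeft ℂ σ p) = MvPolynomial.optionEquivLeft ℂ σ p := by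
  classical
  refine MvPolynomial.hom_congr_vars
    (f₁ := (Polynomial.mapRingHom ((MvPolynomial.C (σ := σ)).comp (MvPolynomial.eval 0))).comp
      (MvPolynomial.optionEquivLeft ℂ σ :
        MvPolynomial (Option σ) ℂ →+* Polynomial (MvPolynomial σ ℂ)))
    (f₂ := (MvPolynomial.optionEquivLeft ℂ σ :
        MvPolynomial (Option σ) ℂ →+* Polynomial (MvPolynomial σ ℂ))) ?_ ?_ rfl
  · ext1 a
    simp
  · rintro (_ | i) hi -
    · simp
    · have h := hp i
      rw [MvPolynomial.degreeOf_def, Multiset.count_eq_zero] at h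
      rw [MvPolynomial.vars_def, Multiset.mem_toFinset] at hi
      exact absurd hi h

theorem map_det_generic (A B : Matrix (Fin n) (Fin n) ℂ) (x : ParamSS r n → ℂ) :
    (pencilMatrix (genericA r A) (genericB r B)).det.map (MvPolynomial.eval x) =
      pencilPoly n (A + PhiSSA n r x) (B + PhiSSB n r x) := by
  rw [← Polynomial.coe_mapRingHom, RingHom.map_det, RingHom.mapMatrix_apply, pencilMatrix_map,
    genericA_map_eval, genericB_map_eval]
  rfl

theorem det_generic_ne_zero {A B : Matrix (Fin n) (Fin n) ℂ} (hreg : PencilRegular n A B) :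
    (pencilMatrix (genericA r A) (genericB r B)).det ≠ 0 := by
  intro h
  have h0 := map_det_generic (r := r) A B 0
  rw [h, Polynomial.map_zero, PhiSSA_zero, PhiSSB_zero, add_zero, add_zero] at h0
  exact hreg h0.symm

theorem dvd_pencilPoly_of_cube_dvd {A B : Matrix (Fin n) (Fin n) ℂ} (hreg : PencilRegular n A B)
    {p : Polynomial (MvPolynomial (ParamSS r n) ℂ)}
    (hp : p ^ 3 ∣ (pencilMatrix (genericA r A) (genericB r B)).det) :
    p ∣ (pencilPoly n A B).map MvPolynomial.C := by
  have hD0 := det_generic_ne_zero (r := r) hreg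
  have hdvd : p ∣ (pencilMatrix (genericA r A) (genericB r B)).det :=
    (dvd_pow_self p three_ne_zero).trans hp
  obtain ⟨p, rfl⟩ := (MvPolynomial.optionEquivLeft ℂ (ParamSS r n)).surjective p
  have hD : (pencilMatrix (genericA r A) (genericB r B)).det =
      MvPolynomial.optionEquivLeft ℂ (ParamSS r n) (genericPencil r A B).det := by
    rw [← genericPencil_map, ← RingHom.mapMatrix_apply, ← RingHom.map_det]
    rfl
  have hfix : Polynomial.mapRingHom ((MvPolynomial.C (σ := ParamSS r n)).comp (MvPolynomial.eval 0))
      (MvPolynomial.optionEquivLeft ℂ (ParamSS r n) p) =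
      MvPolynomial.optionEquivLeft ℂ (ParamSS r n) p := by
    refine map_eq_self_of_degreeOf_eq_zero fun i => ?_
    rw [hD, ← map_pow, map_dvd_iff] at hp
    rw [hD, Ne, EmbeddingLike.map_eq_zero_iff] at hD0
    obtain ⟨s, hs⟩ := hp
    have hdeg := degreeOf_det_genericPencil_le A B i
    rw [hs] at hD0 hdeg
    have hp0 : p ≠ 0 := by
      rintro rfl
      simp at hD0
    rw [MvPolynomial.degreeOf_mul_eq (pow_ne_zero 3 hp0) (right_ne_zero_of_mul hD0),
      MvPolynomial.degreeOf_pow_eq _ _ _ hp0] at hdeg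
    omega
  rw [← hfix]
  have h := map_dvd (Polynomial.mapRingHom ((MvPolynomial.C (σ := ParamSS r n)).comp
    (MvPolynomial.eval 0))) hdvd
  rw [Polynomial.coe_mapRingHom, ← Polynomial.map_map, ← Polynomial.map_map, map_det_generic,
    PhiSSA_zero, PhiSSB_zero, add_zero, add_zero, Polynomial.map_map] at h
  exact h

theorem exists_mul_pow_mem_span {A B : Matrix (Fin n) (Fin n) ℂ} (hreg : PencilRegular n A B) :
    ∃ h : MvPolynomial (ParamSS r n) ℂ, h ≠ 0 ∧ ∃ N : ℕ,
      Polynomial.C h * (pencilPoly n A B).map MvPolynomial.C ^ N ∈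
        Ideal.span {(pencilMatrix (genericA r A) (genericB r B)).det,
          Polynomial.derivative (pencilMatrix (genericA r A) (genericB r B)).det,
          Polynomial.derivative
            (Polynomial.derivative (pencilMatrix (genericA r A) (genericB r B)).det)} := by
  set D := (pencilMatrix (genericA r A) (genericB r B)).det with hD
  set P : Polynomial (MvPolynomial (ParamSS r n) ℂ) := (pencilPoly n A B).map MvPolynomial.C with hP
  set I := Ideal.span {D, Polynomial.derivative D,
    Polynomial.derivative (Polynomial.derivative D)} with hI
  by_contra! hcon
  set S : Submonoid (Polynomial (MvPolynomial (ParamSS r n) ℂ)) :=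
    (nonZeroDivisors (MvPolynomial (ParamSS r n) ℂ)).map
      (Polynomial.C : MvPolynomial (ParamSS r n) ℂ →+* _) ⊔ Submonoid.powers P with hS
  have hdisj : Disjoint (I : Set (Polynomial (MvPolynomial (ParamSS r n) ℂ))) S := by
    rw [Set.disjoint_left]
    intro f hfI hfS
    obtain ⟨-, ⟨h, hh, rfl⟩, -, ⟨N, rfl⟩, rfl⟩ := Submonoid.mem_sup.mp hfS
    exact hcon h (nonZeroDivisors.ne_zero hh) N hfI
  obtain ⟨𝔭, h𝔭, hle, hdis⟩ := Ideal.exists_le_prime_disjoint I S hdisj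
  rw [Set.disjoint_left] at hdis
  have hD𝔭 : D ∈ 𝔭 := hle (Ideal.subset_span (by simp))
  have hconst : ∀ a : MvPolynomial (ParamSS r n) ℂ, Polynomial.C a ∈ 𝔭 → a = 0 := by
    intro a ha
    by_contra hne
    exact hdis ha ((le_sup_left : _ ≤ S)
      ⟨a, mem_nonZeroDivisors_of_ne_zero hne, rfl⟩)
  have hbot : 𝔭 ≠ ⊥ := by
    rintro rfl
    exact det_generic_ne_zero hreg ((Submodule.mem_bot _).mp hD𝔭)
  obtain ⟨p, hprime, hp, hdvd⟩ := exists_prime_dvd_of_mem h𝔭 hbot hconst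
  have hdeg : p.natDegree ≠ 0 := by
    intro h0
    obtain ⟨a, rfl⟩ := Polynomial.natDegree_eq_zero.mp h0
    exact hprime.ne_zero (by rw [hconst a hp, map_zero])
  have hcube := cube_dvd_of_dvd_derivative hprime hdeg (hdvd D hD𝔭)
    (hdvd _ (hle (Ideal.subset_span (by simp)))) (hdvd _ (hle (Ideal.subset_span (by simp))))
  exact hdis (Ideal.mem_of_dvd 𝔭 (dvd_pencilPoly_of_cube_dvd hreg hcube) hp)
    ((le_sup_right : _ ≤ S) (Submonoid.mem_powers P))

theorem generically_rootMultiplicity_le {A B : Matrix (Fin n) (Fin n) ℂ}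
    (hreg : PencilRegular n A B) :
    Generically fun x : ParamSS r n → ℂ => ∀ z : ℂ, (pencilPoly n A B).eval z ≠ 0 →
      (pencilPoly n (A + PhiSSA n r x) (B + PhiSSB n r x)).rootMultiplicity z ≤ 2 := by
  obtain ⟨h, hne, N, hmem⟩ := exists_mul_pow_mem_span (r := r) hreg
  refine ⟨h, hne, fun x hx z hz => ?_⟩
  by_contra! hlt
  set ev : Polynomial (MvPolynomial (ParamSS r n) ℂ) →+* ℂ :=
    (Polynomial.evalRingHom z).comp (Polynomial.mapRingHom (MvPolynomial.eval x)) with hev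
  have hroot : ∀ k ≤ 2, (Polynomial.derivative^[k]
      (pencilPoly n (A + PhiSSA n r x) (B + PhiSSB n r x))).eval z = 0 := fun k hk =>
    Polynomial.isRoot_iterate_derivative_of_lt_rootMultiplicity (hk.trans_lt hlt)
  have hker : Ideal.span {(pencilMatrix (genericA r A) (genericB r B)).det,
      Polynomial.derivative (pencilMatrix (genericA r A) (genericB r B)).det,
      Polynomial.derivative
        (Polynomial.derivative (pencilMatrix (genericA r A) (genericB r B)).det)} ≤
      RingHom.ker ev := by
    rw [Ideal.span_le]
    rintro f (rfl | rfl | rfl)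
    · have := hroot 0 (by omega)
      simpa [hev, RingHom.mem_ker, map_det_generic] using this
    · have := hroot 1 (by omega)
      simpa [hev, RingHom.mem_ker, ← Polynomial.derivative_map, map_det_generic] using this
    · have := hroot 2 (by omega)
      simpa [hev, RingHom.mem_ker, ← Polynomial.derivative_map, map_det_generic] using this
  have h0 := RingHom.mem_ker.mp (hker hmem)
  rw [map_mul, map_pow] at h0
  have h1 : ev (Polynomial.C h) = MvPolynomial.eval x h := by simp [hev]
  have h2 : ev ((pencilPoly n A B).map MvPolynomial.C) = (pencilPoly n A B).eval z := by
    have hid : (MvPolynomial.eval x).comp MvPolynomial.C = RingHom.id ℂ := by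
      ext1 a
      simp
    simp [hev, Polynomial.map_map, hid]
  rw [h1, h2] at h0
  exact mul_ne_zero hx (pow_ne_zero N hz) h0

end NewEigenvalues

section Assembly

variable {n r : ℕ}

theorem eval_pencilPoly (A B : Matrix (Fin n) (Fin n) ℂ) (z : ℂ) :
    (pencilPoly n A B).eval z = (A + z • B).det := by
  rw [pencilPoly, ← Polynomial.coe_evalRingHom, RingHom.map_det]
  congr 1
  ext i j
  simp [mul_comm z]

theorem PencilRegular.reverse {A B : Matrix (Fin n) (Fin n) ℂ} (hreg : PencilRegular n A B) :
    PencilRegular n B A := by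
  intro h
  refine hreg (Polynomial.eq_zero_of_infinite_isRoot _
    ((Set.finite_singleton (0 : ℂ)).infinite_compl.mono fun z hz => ?_))
  have hz0 : z ≠ 0 := hz
  have h1 : A + z • B = z • (B + z⁻¹ • A) := by
    rw [smul_add, smul_smul, mul_inv_cancel₀ hz0, one_smul, add_comm]
  have h2 : (B + z⁻¹ • A).det = 0 := by rw [← eval_pencilPoly, h, Polynomial.eval_zero]
  rw [Set.mem_ofPred_eq, Polynomial.IsRoot, eval_pencilPoly, h1, Matrix.det_smul, h2, mul_zero]

theorem generically_pmAt (hr : Even r) {A B : Matrix (Fin n) (Fin n) ℂ} (hA : Aᵀ = -A)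
    (hB : Bᵀ = -B) (hreg : PencilRegular n A B) (μ : Option ℂ) {g : ℕ} {f : ℕ → ℕ}
    (hf : ∀ j k, j ≤ k → f k ≤ f j) (hpos : ∀ j, 0 < f j ↔ j < g)
    (hpm : pmAt n A B μ = (Multiset.range g).map f) :
    Generically fun x : ParamSS r n → ℂ => pmAt n (A + PhiSSA n r x) (B + PhiSSB n r x) μ =
      (Multiset.range (g - r)).map fun j => f (r + j) := by
  cases μ with
  | some z =>
    refine ((generically_regular hreg).and (generically_minOrder_shift hr hA hB z)).mono ?_
    rintro x ⟨hx, hshift⟩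
    exact pmFin_of_minOrder_shift hr hA hB (add_PhiSSA_transpose hA x) (add_PhiSSB_transpose hB x)
      hreg hx hf hpos hpm hshift
  | none =>
    refine ((generically_regular hreg).and (generically_minOrder_reverse_shift hr hA hB 0)).mono ?_
    rintro x ⟨hx, hshift⟩
    exact pmFin_of_minOrder_shift hr hB hA (add_PhiSSB_transpose hB x) (add_PhiSSA_transpose hA x)
      hreg.reverse hx.reverse hf hpos hpm hshift

theorem generically_algMultAt_eq_two {A B : Matrix (Fin n) (Fin n) ℂ} (hA : Aᵀ = -A)
    (hB : Bᵀ = -B) (hreg : PencilRegular n A B) :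
    Generically fun x : ParamSS r n → ℂ => ∀ μ : Option ℂ,
      IsEigenvalue n (A + PhiSSA n r x) (B + PhiSSB n r x) μ → ¬ IsEigenvalue n A B μ →
      algMultAt n (A + PhiSSA n r x) (B + PhiSSB n r x) μ = 2 := by
  have hinf : Generically fun x : ParamSS r n → ℂ => ¬ IsEigenvalue n A B none →
      (pencilPoly n (B + PhiSSB n r x) (A + PhiSSA n r x)).rootMultiplicity 0 = 0 := by
    by_cases h : IsEigenvalue n A B none
    · exact Generically.of_forall fun x hx => absurd h hx
    · refine (generically_not_infinite_root hreg.reverse ?_).mono fun x hx _ => hx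
      exact not_not.mp (mt (pmFin_ne_zero_iff hB hA hreg.reverse 0).mpr h)
  refine ((generically_regular hreg).and (hinf.and (generically_rootMultiplicity_le hreg))).mono ?_
  rintro x ⟨hx, hxinf, hle⟩ (_ | z) hμ hnot
  · exact absurd (hxinf hnot) ((pmFin_ne_zero_iff (add_PhiSSB_transpose hB x)
      (add_PhiSSA_transpose hA x) hx.reverse 0).mp hμ)
  · have hne := (pmFin_ne_zero_iff (add_PhiSSA_transpose hA x)
      (add_PhiSSB_transpose hB x) hx z).mp hμ
    have heven := even_rootMultiplicity (add_PhiSSA_transpose hA x)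
      (add_PhiSSB_transpose hB x) hx z
    have hz : (pencilPoly n A B).eval z ≠ 0 := fun h0 => hnot
      ((pmFin_ne_zero_iff hA hB hreg z).mpr
        ((Polynomial.rootMultiplicity_pos hreg).mpr h0).ne')
    have h2 := hle z hz
    obtain ⟨m, hm⟩ := heven
    simp only [algMultAt]
    omega

end Assembly

/-- **Generic change under low-rank structure-preserving perturbations of complex
skew-symmetric pencils.** If `L(λ) = A + λB` is a regular skew-symmetric pencil with
pairwise distinct eigenvalues `Λ 1, …, Λ κ` (finite or infinite) with partial
multiplicities `nn i 0 ≥ … ≥ nn i (g i − 1) > 0`, and `r` is a positive even integer,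
then there is a generic set `G ⊆ ℂ^{(3r/2) n}` such that for all `x ∈ G`, with
`E = Φ(x)`: `L + E` is regular; the partial multiplicities of `L + E` at `Λ i` are
exactly `nn i r ≥ … ≥ nn i (g i − 1)` (so if `r ≥ g i` then `Λ i` is not an
eigenvalue of `L + E`); and every eigenvalue of `L + E` that is not an eigenvalue of
`L` has algebraic multiplicity exactly two. -/
theorem generic_low_rank_perturbation_skew_symmetric
    (n κ r : ℕ) (hr : 1 ≤ r) (hreven : Even r)
    (A B : Matrix (Fin n) (Fin n) ℂ)
    (hA : Aᵀ = -A) (hB : Bᵀ = -B)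
    (hreg : PencilRegular n A B)
    (Λ : Fin κ → Option ℂ) (hΛ : Function.Injective Λ)
    (heig : ∀ μ : Option ℂ, IsEigenvalue n A B μ ↔ ∃ i, Λ i = μ)
    (g : Fin κ → ℕ) (nn : Fin κ → ℕ → ℕ)
    (hmono : ∀ i, ∀ j k : ℕ, j ≤ k → nn i k ≤ nn i j)
    (hgpos : ∀ i, ∀ j : ℕ, 0 < nn i j ↔ j < g i)
    (hpm : ∀ i, pmAt n A B (Λ i) = (Multiset.range (g i)).map (nn i)) :
    ∃ G : Set (ParamSS r n → ℂ), IsGenericC (ParamSS r n) G ∧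
      ∀ x ∈ G,
        PencilRegular n (A + PhiSSA n r x) (B + PhiSSB n r x) ∧
        (∀ i, pmAt n (A + PhiSSA n r x) (B + PhiSSB n r x) (Λ i)
            = (Multiset.range (g i - r)).map fun j => nn i (r + j)) ∧
        (∀ μ : Option ℂ,
          IsEigenvalue n (A + PhiSSA n r x) (B + PhiSSB n r x) μ →
          ¬ IsEigenvalue n A B μ →
          algMultAt n (A + PhiSSA n r x) (B + PhiSSB n r x) μ = 2) := by
  refine ⟨_, ((generically_regular hreg).and ((Generically.forall_fintype fun i =>
    generically_pmAt hreven hA hB hreg (Λ i) (hmono i) (hgpos i) (hpm i)).and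
      (generically_algMultAt_eq_two hA hB hreg))).isGenericC, fun x hx => hx⟩
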